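/- arXiv:2008.13130 — 2 statements merged into one kernel-verified Lean document; each statement's English description precedes it below -/
import Mathlib

section
/- Root approximation in a valued field: Let K be an algebraically closed field equipped with an additive valuation ν : K → ℝ ∪ {∞} (satisfying ν(ab) = ν(a) + ν(b), ν(a+b) ≥ min(ν(a),ν(b)), and ν(a) = ∞ if and only if a = 0), and let V = {a ∈ K : ν(a) ≥ 0} be its valuation ring. Let P ∈ V[y] be a monic polynomial of degree d having d distinct roots ξ₁,…,ξ_d in K, and let Q ∈ V[y] be a monic polynomial with Q ≠ P such that 2·ν(P − Q) > d·ν(Δ_P), where Δ_P is the discriminant of P and, for a nonzero polynomial R, ν(R) denotes the minimum of the valuations of the nonzero coefficients of R. Then for every i = 1,…,d, the polynomial Q has exactly one root ξ'ᵢ in K satisfying ν(ξᵢ − ξ'ᵢ) ≥ ν(P − Q)/d. -/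
noncomputable section

namespace AddValuation

open Polynomial

section Ring

variable {R Γ₀ : Type*} [CommRing R] [LinearOrderedAddCommMonoidWithTop Γ₀]
  (v : AddValuation R Γ₀)

theorem map_prod {ι : Type*} (s : Finset ι) (f : ι → R) :
    v (∏ i ∈ s, f i) = ∑ i ∈ s, v (f i) := by
  classical
  induction s using Finset.induction_on with
  | empty => simp
  | insert a s ha ih => rw [Finset.prod_insert ha, Finset.sum_insert ha, v.map_mul, ih]

theorem le_map_eval {p : R[X]} {x : R} {g : Γ₀} (hp : ∀ j, g ≤ v (p.coeff j)) (hx : 0 ≤ v x) :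
    g ≤ v (p.eval x) := by
  rw [eval_eq_sum_range]
  refine v.map_le_sum fun j _ => ?_
  rw [v.map_mul, v.map_pow]
  exact le_add_of_le_of_nonneg (hp j) (nsmul_nonneg hx j)

end Ring

section Field

variable {K : Type*} [Field K] (v : AddValuation K (WithTop ℝ))

theorem nonneg_of_isRoot_of_monic {p : K[X]} (hm : p.Monic) (hp : ∀ j, 0 ≤ v (p.coeff j))
    {x : K} (hx : p.IsRoot x) : 0 ≤ v x := by
  by_contra! hlt
  obtain ⟨c, hc⟩ := WithTop.ne_top_iff_exists.1 hlt.ne_top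
  have hc0 : c < 0 := by rw [← hc] at hlt; exact_mod_cast hlt
  have hpow : ∀ n : ℕ, v (x ^ n) = ((n * c : ℝ) : WithTop ℝ) := fun n => by
    rw [v.map_pow, ← hc, ← WithTop.coe_nsmul, nsmul_eq_mul]
  have h0 : p.eval x = 0 := hx
  rw [eval_eq_sum_range, Finset.sum_range_succ, hm.coeff_natDegree, one_mul] at h0
  have hlead : v (x ^ p.natDegree) < v (∑ j ∈ Finset.range p.natDegree, p.coeff j * x ^ j) := by
    rw [hpow]
    refine v.map_lt_sum WithTop.coe_ne_top fun j hj => ?_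
    rw [v.map_mul, hpow]
    refine lt_of_lt_of_le (WithTop.coe_lt_coe.2 ?_) (le_add_of_nonneg_left (hp j))
    exact mul_lt_mul_of_neg_right (by exact_mod_cast Finset.mem_range.1 hj) hc0
  rw [eq_neg_of_add_eq_zero_left h0, v.map_neg] at hlead
  exact lt_irrefl _ hlead

/-- If a product of `n ≥ 1` elements has value at least `r`, some factor has value at least
`r / n`. -/
theorem exists_div_card_le_of_le_prod {s : Multiset K} (hs : s ≠ 0) {r : ℝ}
    (hr : (r : WithTop ℝ) ≤ v s.prod) :
    ∃ x ∈ s, ((r / s.card : ℝ) : WithTop ℝ) ≤ v x := by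
  by_contra! h
  have key : ∀ (c : ℝ) (t : Multiset K), (∀ x ∈ t, v x < c) → t ≠ 0 →
      v t.prod < ((t.card * c : ℝ) : WithTop ℝ) := by
    intro c t
    induction t using Multiset.induction_on with
    | empty => intro _ h; exact absurd rfl h
    | cons a t ih =>
      intro ht _
      have ha := ht a (Multiset.mem_cons_self a t)
      rcases eq_or_ne t 0 with rfl | ht0
      · simpa using ha
      have iht := ih (fun x hx => ht x (Multiset.mem_cons_of_mem hx)) ht0
      rw [Multiset.prod_cons, v.map_mul]
      obtain ⟨a', ha'⟩ := WithTop.ne_top_iff_exists.1 ha.ne_top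
      obtain ⟨b', hb'⟩ := WithTop.ne_top_iff_exists.1 iht.ne_top
      rw [← ha'] at ha ⊢
      rw [← hb'] at iht ⊢
      rw [← WithTop.coe_add, WithTop.coe_lt_coe, Multiset.card_cons]
      rw [WithTop.coe_lt_coe] at ha iht
      push_cast
      linarith
  have hlt := hr.trans_lt (key _ s h hs)
  have hcard : (s.card : ℝ) ≠ 0 := by simpa using hs
  rw [WithTop.coe_lt_coe, mul_div_cancel₀ _ hcard] at hlt
  exact lt_irrefl _ hlt

/-- In a finite family of integral elements, the separation of any two distinct members is at most
half the value of the discriminant. -/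
theorem add_self_le_map_prod_offDiag {ι : Type*} [Fintype ι] [DecidableEq ι] {ξ : ι → K}
    (hξ : ∀ i, 0 ≤ v (ξ i)) {i k : ι} (hik : i ≠ k) :
    v (ξ i - ξ k) + v (ξ i - ξ k) ≤
      v (∏ pr ∈ Finset.univ.offDiag, (ξ pr.1 - ξ pr.2)) := by
  rw [v.map_prod]
  have hsub : ({(i, k), (k, i)} : Finset (ι × ι)) ⊆ Finset.univ.offDiag := by
    intro x hx
    simp only [Finset.mem_insert, Finset.mem_singleton] at hx
    rcases hx with rfl | rfl <;> simp [hik, hik.symm]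
  refine le_trans (le_of_eq ?_) (Finset.sum_le_sum_of_subset_of_nonneg hsub
    fun x _ _ => v.map_le_sub (hξ _) (hξ _))
  rw [Finset.sum_pair (by simp [hik]), v.map_sub_swap (ξ k)]

end Field

end AddValuation

/-- **Root approximation in a valued field.** Let `K` be an algebraically closed field with
an additive valuation `ν : K → ℝ ∪ {∞}` and valuation ring `V = {a | ν a ≥ 0}`. Let
`P ∈ V[y]` be monic of degree `d` with `d` distinct roots `ξ₁, …, ξ_d`, and let `Q ∈ V[y]`
be monic with `Q ≠ P` and `2·ν(P - Q) > d·ν(Δ_P)` (the valuations `ν(P-Q) = r` and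
`ν(Δ_P) = δ` are finite and named explicitly; `Δ_P = ±∏_{i≠j}(ξᵢ - ξⱼ)`). Then for each `i`,
`Q` has exactly one root `z` with `ν(ξᵢ - z) ≥ ν(P - Q)/d`. -/
theorem root_approximation {K : Type*} [Field K] [IsAlgClosed K]
    (ν : K → WithTop ℝ)
    (hν0 : ∀ a : K, ν a = ⊤ ↔ a = 0)
    (hνmul : ∀ a b : K, ν (a * b) = ν a + ν b)
    (hνadd : ∀ a b : K, min (ν a) (ν b) ≤ ν (a + b))
    (d : ℕ) (ξ : Fin d → K) (hξ : Function.Injective ξ)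
    (P Q : Polynomial K)
    (hP : P = ∏ i : Fin d, (Polynomial.X - Polynomial.C (ξ i)))
    (hPV : ∀ j : ℕ, 0 ≤ ν (P.coeff j)) (hQV : ∀ j : ℕ, 0 ≤ ν (Q.coeff j))
    (hQmonic : Q.Monic) (hne : Q ≠ P)
    (r δ : ℝ)
    (hr : ((Finset.range ((P - Q).natDegree + 1)).inf fun j => ν ((P - Q).coeff j))
        = (r : WithTop ℝ))
    (hδ : ν (∏ pr ∈ Finset.univ.offDiag, (ξ pr.1 - ξ pr.2)) = (δ : WithTop ℝ))
    (hmain : (d : ℝ) * δ < 2 * r) :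
    ∀ i : Fin d, ∃! z : K,
      Polynomial.eval z Q = 0 ∧ ((r / d : ℝ) : WithTop ℝ) ≤ ν (ξ i - z) := by
  intro i
  classical
  have hone : ν 1 = 0 := by
    have hne1 : ν 1 ≠ ⊤ := fun h => one_ne_zero ((hν0 1).1 h)
    obtain ⟨c, hc⟩ := WithTop.ne_top_iff_exists.1 hne1
    have h := hνmul 1 1
    rw [mul_one, ← hc, ← WithTop.coe_add, WithTop.coe_inj] at h
    rw [← hc, show c = 0 by linarith, WithTop.coe_zero]
  let v : AddValuation K (WithTop ℝ) := AddValuation.of ν ((hν0 0).2 rfl) hone hνadd hνmul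
  change ∃! z : K, Q.eval z = 0 ∧ ((r / d : ℝ) : WithTop ℝ) ≤ v (ξ i - z)
  have hd : (0 : ℝ) < d := by exact_mod_cast i.pos
  have hPmonic : P.Monic := hP ▸ Polynomial.monic_prod_X_sub_C ξ Finset.univ
  have hPdeg : P.natDegree = d := by
    rw [hP, Polynomial.natDegree_finsetProd_X_sub_C_eq_card, Finset.card_univ, Fintype.card_fin]
  have hPξ : ∀ k, P.eval (ξ k) = 0 := fun k => by
    rw [hP, Polynomial.eval_prod]
    exact Finset.prod_eq_zero (Finset.mem_univ k) (by simp)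
  have hξ0 : ∀ k, 0 ≤ v (ξ k) := fun k => v.nonneg_of_isRoot_of_monic hPmonic hPV (hPξ k)
  have hδ0 : 0 ≤ δ := by
    have h : 0 ≤ v (∏ pr ∈ Finset.univ.offDiag, (ξ pr.1 - ξ pr.2)) := by
      rw [v.map_prod]
      exact Finset.sum_nonneg fun x _ => v.map_le_sub (hξ0 _) (hξ0 _)
    exact WithTop.coe_le_coe.1 (h.trans_eq hδ)
  have hr0 : 0 < r := by nlinarith [mul_nonneg hd.le hδ0]
  have hcoeff : ∀ j, (r : WithTop ℝ) ≤ v ((P - Q).coeff j) := fun j => by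
    by_cases hj : j ∈ Finset.range ((P - Q).natDegree + 1)
    · exact hr.symm.trans_le (Finset.inf_le hj)
    · rw [Polynomial.coeff_eq_zero_of_natDegree_lt (by simpa [Nat.lt_succ_iff] using hj),
        v.map_zero]
      exact le_top
  have hone_lt : ¬ (r : WithTop ℝ) ≤ v 1 := by
    rw [v.map_one, not_le]
    exact_mod_cast hr0
  have hQdeg : Q.natDegree = d := by
    rw [← hPdeg]
    rcases lt_trichotomy Q.natDegree P.natDegree with h | h | h
    · have h1 := hcoeff P.natDegree
      rw [Polynomial.coeff_sub, hPmonic.coeff_natDegree,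
        Polynomial.coeff_eq_zero_of_natDegree_lt h, sub_zero] at h1
      exact absurd h1 hone_lt
    · exact h
    · have h1 := hcoeff Q.natDegree
      rw [Polynomial.coeff_sub, hQmonic.coeff_natDegree,
        Polynomial.coeff_eq_zero_of_natDegree_lt h, zero_sub, v.map_neg] at h1
      exact absurd h1 hone_lt
  have hsplit : Q.Splits := IsAlgClosed.splits Q
  have hcard : Q.roots.card = d := by rw [← hsplit.natDegree_eq_card_roots, hQdeg]
  have hexists : ∀ k, ∃ z ∈ Q.roots, ((r / d : ℝ) : WithTop ℝ) ≤ v (ξ k - z) := fun k => by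
    have h := v.le_map_eval hcoeff (hξ0 k)
    rw [Polynomial.eval_sub, hPξ, zero_sub, v.map_neg,
      hsplit.eval_eq_prod_roots_of_monic hQmonic] at h
    have hs : Q.roots.map (ξ k - ·) ≠ 0 := by
      rw [← Multiset.card_pos, Multiset.card_map, hcard]
      exact i.pos
    obtain ⟨x, hx, hle⟩ := v.exists_div_card_le_of_le_prod hs h
    obtain ⟨z, hz, rfl⟩ := Multiset.mem_map.1 hx
    exact ⟨z, hz, by rwa [Multiset.card_map, hcard] at hle⟩
  have hsep : ∀ k l z, ((r / d : ℝ) : WithTop ℝ) ≤ v (ξ k - z) →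
      ((r / d : ℝ) : WithTop ℝ) ≤ v (ξ l - z) → k = l := fun k l z hk hl => by
    by_contra hkl
    have h : ((r / d : ℝ) : WithTop ℝ) ≤ v (ξ k - ξ l) := by
      rw [← sub_sub_sub_cancel_right (ξ k) (ξ l) z]
      exact v.map_le_sub hk hl
    have h2 := (add_le_add h h).trans
      ((v.add_self_le_map_prod_offDiag hξ0 hkl).trans_eq hδ)
    rw [← WithTop.coe_add, WithTop.coe_le_coe, ← add_div, div_le_iff₀ hd] at h2
    linarith
  choose f hf hfle using hexists
  have hfinj : Function.Injective f := fun k l hkl =>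
    hsep k l (f k) (hfle k) (hkl ▸ hfle l)
  have himage : Finset.univ.image f = Q.roots.toFinset := by
    refine Finset.eq_of_subset_of_card_le ?_ ?_
    · intro z hz
      obtain ⟨k, -, rfl⟩ := Finset.mem_image.1 hz
      exact Multiset.mem_toFinset.2 (hf k)
    · rw [Finset.card_image_of_injective _ hfinj, Finset.card_univ, Fintype.card_fin]
      exact (Multiset.toFinset_card_le _).trans_eq hcard
  refine ⟨f i, ⟨Polynomial.isRoot_of_mem_roots (hf i), hfle i⟩, ?_⟩
  rintro z ⟨hz, hzle⟩
  have hmem : z ∈ Finset.univ.image f := by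
    rw [himage, Multiset.mem_toFinset]
    exact (Polynomial.mem_roots hQmonic.ne_zero).2 hz
  obtain ⟨k, -, rfl⟩ := Finset.mem_image.1 hmem
  rw [hsep k i (f k) (hfle k) hzle]
end
end

section
/- Bernstein–Walsh-type inequality on an irreducible algebraic curve: Let C ⊆ ℂⁿ be an irreducible algebraic curve, i.e. the zero set of a prime ideal of ℂ[z₁,…,zₙ] such that the quotient ring has Krull dimension 1. Let D₁ and D₂ be compact subsets of C such that D₁ has nonempty interior in C (for the subspace topology on C). Then there exists M > 0 such that for every polynomial P ∈ ℂ[z₁,…,zₙ], one has sup_{z ∈ D₂} |P(z)| ≤ M^{deg(P)} · sup_{z ∈ D₁} |P(z)|, where deg(P) is the total degree of P. -/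
noncomputable section

section Auxiliary

open Polynomial

/-- A point of the spectrum of a finitely generated `ℂ`-algebra lying on a proper ideal. -/
theorem exists_algHom_complex_of_ne_top {B : Type*} [CommRing B] [Algebra ℂ B]
    [Algebra.FiniteType ℂ B] {I : Ideal B} (hI : I ≠ ⊤) :
    ∃ φ : B →ₐ[ℂ] ℂ, ∀ b ∈ I, φ b = 0 := by
  obtain ⟨M, hM, hIM⟩ := Ideal.exists_le_maximal I hI
  let _ := Ideal.Quotient.field M
  have : Algebra.FiniteType ℂ (B ⧸ M) := inferInstance
  have : Module.Finite ℂ (B ⧸ M) := finite_of_finite_type_of_isJacobsonRing ℂ (B ⧸ M)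
  let e : (B ⧸ M) →ₐ[ℂ] ℂ := IsAlgClosed.lift
  refine ⟨e.comp (Ideal.Quotient.mkₐ ℂ M), fun b hb => ?_⟩
  have : (Ideal.Quotient.mkₐ ℂ M) b = 0 := Ideal.Quotient.eq_zero_iff_mem.2 (hIM hb)
  rw [AlgHom.comp_apply, this, map_zero]

theorem norm_le_of_monic_of_coeff_le {p : ℂ[X]} (hp : p.Monic) {H : ℝ} (hH : 0 ≤ H)
    (hc : ∀ i, ‖p.coeff i‖ ≤ H ^ (p.natDegree - i) * p.natDegree.choose i) {z : ℂ}
    (hz : p.eval z = 0) : ‖z‖ ≤ 2 ^ p.natDegree * H := by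
  set m := p.natDegree with hm
  by_contra! hlt
  have hHz : H ≤ ‖z‖ := by
    refine le_trans ?_ hlt.le
    exact le_mul_of_one_le_left hH (one_le_pow₀ (by norm_num))
  have hz0 : 0 < ‖z‖ := lt_of_le_of_lt (by positivity) hlt
  have h1 : z ^ m = -∑ i ∈ Finset.range m, p.coeff i * z ^ i := by
    rw [eval_eq_sum_range, Finset.sum_range_succ, ← hm] at hz
    have : p.coeff m = 1 := hp
    rw [this] at hz
    linear_combination hz
  rcases Nat.eq_zero_or_pos m with h0 | hpos
  · rw [h0] at h1
    simp at h1
  have h2 : ‖z‖ ^ m ≤ ∑ i ∈ Finset.range m, H * ‖z‖ ^ (m - 1) * m.choose i := by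
    rw [← norm_pow, h1, norm_neg]
    refine (norm_sum_le _ _).trans (Finset.sum_le_sum fun i hi => ?_)
    have hi := Finset.mem_range.1 hi
    rw [norm_mul, norm_pow]
    calc ‖p.coeff i‖ * ‖z‖ ^ i ≤ (H ^ (m - i) * m.choose i) * ‖z‖ ^ i := by
          gcongr; exact hc i
      _ = H * (H ^ (m - i - 1) * ‖z‖ ^ i) * m.choose i := by
          rw [show m - i = (m - i - 1) + 1 by omega, pow_succ]; simp; ring
      _ ≤ H * (‖z‖ ^ (m - i - 1) * ‖z‖ ^ i) * m.choose i := by gcongr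
      _ = _ := by rw [← pow_add]; congr 3; omega
  have h3 : ∑ i ∈ Finset.range m, H * ‖z‖ ^ (m - 1) * (m.choose i : ℝ)
      ≤ H * ‖z‖ ^ (m - 1) * 2 ^ m := by
    rw [← Finset.mul_sum]
    gcongr
    have := Nat.sum_range_choose m
    rw [Finset.sum_range_succ] at this
    have h : ∑ i ∈ Finset.range m, m.choose i ≤ 2 ^ m := by omega
    exact_mod_cast h
  have h4 : ‖z‖ ^ m = ‖z‖ * ‖z‖ ^ (m - 1) := by
    rw [← pow_succ']; congr 1; omega
  have h5 : 0 < ‖z‖ ^ (m - 1) := by positivity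
  nlinarith

/-- Every root of a specialised characteristic polynomial of `h` is a value of `h` at a point
of the fibre. -/
theorem exists_algHom_of_isRoot_charpoly {B : Type*} [CommRing B] [Algebra ℂ B]
    [Algebra ℂ[X] B] [IsScalarTower ℂ ℂ[X] B] [Module.Finite ℂ[X] B]
    {ι : Type*} [Fintype ι] [DecidableEq ι] (b : Module.Basis ι ℂ[X] B) (h : B) (τ c : ℂ)
    (hc : (((Algebra.leftMulMatrix b h).charpoly).map (evalRingHom τ)).eval c = 0) :
    ∃ φ : B →ₐ[ℂ] ℂ, φ (algebraMap ℂ[X] B X) = τ ∧ φ h = c := by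
  have : Algebra.FiniteType ℂ B := Algebra.FiniteType.trans (S := ℂ[X]) inferInstance inferInstance
  set I : Ideal B := Ideal.span {algebraMap ℂ[X] B (X - C τ), algebraMap ℂ B c - h} with hI
  have hI' : I ≠ ⊤ := by
    intro htop
    have h1 : (1 : B) ∈ I := htop ▸ Submodule.mem_top
    rw [hI, Ideal.mem_span_pair] at h1
    obtain ⟨u, w, huw⟩ := h1
    have h2 : w * (algebraMap ℂ B c - h) = 1 - (X - C τ) • u := by
      rw [Algebra.smul_def]; linear_combination huw
    have h3 := congrArg (fun y => (Algebra.leftMulMatrix b y).det.eval τ) h2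
    simp only [map_mul, map_sub, map_one, map_smul, Matrix.det_mul, eval_mul] at h3
    have h4 : (1 - (X - C τ) • Algebra.leftMulMatrix b u).det.eval τ = 1 := by
      rw [← coe_evalRingHom, RingHom.map_det]
      have : (evalRingHom τ).mapMatrix (1 - (X - C τ) • Algebra.leftMulMatrix b u) = 1 := by
        ext i j
        by_cases hij : i = j <;> simp [hij, Matrix.one_apply]
      rw [this, Matrix.det_one]
    have h5 : (Algebra.leftMulMatrix b (algebraMap ℂ B c) -
        Algebra.leftMulMatrix b h).det.eval τ = 0 := by
      rw [IsScalarTower.algebraMap_apply ℂ ℂ[X] B, AlgHom.commutes, ← hc]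
      rw [eval_map, ← coe_evalRingHom τ, Matrix.charpoly, ← coe_eval₂RingHom, RingHom.map_det,
        RingHom.map_det]
      congr 1
      ext i j
      by_cases hij : i = j
      · subst hij
        simp [Matrix.charmatrix_apply_eq, Matrix.algebraMap_matrix_apply]
      · simp [Matrix.algebraMap_matrix_apply, hij]
    rw [h5, mul_zero] at h3
    rw [h4] at h3
    exact zero_ne_one h3
  obtain ⟨φ, hφ⟩ := exists_algHom_complex_of_ne_top hI'
  refine ⟨φ, ?_, ?_⟩
  · have := hφ (algebraMap ℂ[X] B (X - C τ)) (Ideal.subset_span (by simp))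
    rw [map_sub, map_sub, sub_eq_zero] at this
    rw [this, ← algebraMap_eq, ← IsScalarTower.algebraMap_apply ℂ ℂ[X] B, AlgHom.commutes]
    rfl
  · have := hφ (algebraMap ℂ B c - h) (Ideal.subset_span (by simp))
    rw [map_sub, AlgHom.commutes, sub_eq_zero] at this
    exact this.symm

/-- The maximum principle for the fibration of an affine curve over the complex line. -/
theorem exists_norm_le_of_norm_le_on_circle (B : Type*) [CommRing B] [IsDomain B] [Algebra ℂ B]
    [Algebra ℂ[X] B] [IsScalarTower ℂ ℂ[X] B] [Module.Finite ℂ[X] B] [FaithfulSMul ℂ[X] B] :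
    ∃ c : ℝ, 1 ≤ c ∧ ∀ (h : B) (ρ H : ℝ), 0 < ρ → 0 ≤ H →
      (∀ φ : B →ₐ[ℂ] ℂ, ‖φ (algebraMap ℂ[X] B X)‖ = ρ → ‖φ h‖ ≤ H) →
      ∀ φ : B →ₐ[ℂ] ℂ, ‖φ (algebraMap ℂ[X] B X)‖ ≤ ρ → ‖φ h‖ ≤ c * H := by
  classical
  have : Module.IsTorsionFree ℂ[X] B := inferInstance
  have : Module.Free ℂ[X] B := inferInstance
  let b := Module.Free.chooseBasis ℂ[X] B
  set m := Fintype.card (Module.Free.ChooseBasisIndex ℂ[X] B)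
  refine ⟨2 ^ m, one_le_pow₀ (by norm_num), fun h ρ H hρ hH hcirc φ hφ => ?_⟩
  set χ := (Algebra.leftMulMatrix b h).charpoly with hχ
  have hmonic : χ.Monic := Matrix.charpoly_monic _
  have hdeg : ∀ τ, (χ.map (evalRingHom τ)).natDegree = m := fun τ => by
    rw [hmonic.natDegree_map, hχ, Matrix.charpoly_natDegree_eq_dim]
  have hbd : ∀ τ : ℂ, ‖τ‖ = ρ → ∀ i, ‖(χ.coeff i).eval τ‖ ≤ H ^ (m - i) * m.choose i := by
    intro τ hτ i
    have := coeff_le_of_roots_le (p := χ.map (evalRingHom τ)) (f := RingHom.id ℂ) (B := H) i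
      (hmonic.map _) (IsAlgClosed.splits _) (by
        intro c hc
        rw [Polynomial.map_id] at hc
        obtain ⟨ψ, h1, h2⟩ := exists_algHom_of_isRoot_charpoly b h τ c
          ((mem_roots (hmonic.map _).ne_zero).1 hc)
        rw [← h2]
        exact hcirc ψ (by rw [h1, hτ]))
    rw [hdeg] at this
    simpa using this
  set τ := φ (algebraMap ℂ[X] B X) with hτ
  have hev : ∀ q : ℂ[X], φ (algebraMap ℂ[X] B q) = q.eval τ := by
    intro q
    have : (φ.comp (IsScalarTower.toAlgHom ℂ ℂ[X] B)) = aeval τ := by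
      ext; simp [hτ]
    have h2 := DFunLike.congr_fun this q
    simpa [coe_aeval_eq_eval] using h2
  have hin : ∀ i, ‖(χ.coeff i).eval τ‖ ≤ H ^ (m - i) * m.choose i := by
    intro i
    refine Complex.norm_le_of_forall_mem_frontier_norm_le (U := Metric.ball (0 : ℂ) ρ)
      (f := fun w => (χ.coeff i).eval w) Metric.isBounded_ball
      (χ.coeff i).differentiable.diffContOnCl ?_ ?_
    · intro w hw
      rw [frontier_ball _ hρ.ne'] at hw
      exact hbd w (by simpa using hw) i
    · rw [closure_ball _ hρ.ne']; simpa using hφ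
  have hroot : (χ.map (evalRingHom τ)).eval (φ h) = 0 := by
    have h0 : aeval h χ = 0 := by
      have h1 := Matrix.aeval_self_charpoly (Algebra.leftMulMatrix b h)
      rw [Polynomial.aeval_algHom_apply] at h1
      exact Algebra.leftMulMatrix_injective b (by rw [map_zero]; exact h1)
    have h1 := congrArg φ h0
    rw [map_zero, aeval_def] at h1
    have h2 := Polynomial.hom_eval₂ χ (algebraMap ℂ[X] B) (φ : B →+* ℂ) h
    rw [eval_map, ← h1]
    refine Eq.trans ?_ h2.symm
    congr 1
    exact RingHom.ext fun q => (hev q).symm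
  have := norm_le_of_monic_of_coeff_le (hmonic.map (evalRingHom τ)) hH (z := φ h)
    (by intro i; rw [hdeg]; simpa using hin i) hroot
  rwa [hdeg] at this

/-- Noether normalisation in dimension one. -/
theorem exists_aeval_injective_finite (A : Type*) [CommRing A] [IsDomain A] [Algebra ℂ A]
    [Algebra.FiniteType ℂ A] (hdim : ringKrullDim A = 1) :
    ∃ t : A, Function.Injective (aeval t : ℂ[X] →ₐ[ℂ] A) ∧ (aeval t : ℂ[X] →ₐ[ℂ] A).Finite := by
  obtain ⟨s, g, hinj, hfin⟩ := exists_finite_inj_algHom_of_fg ℂ A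
  let _ : Algebra (MvPolynomial (Fin s) ℂ) A := g.toRingHom.toAlgebra
  have hmod : Module.Finite (MvPolynomial (Fin s) ℂ) A := hfin
  have hint : Algebra.IsIntegral (MvPolynomial (Fin s) ℂ) A := inferInstance
  have hs1 : Ring.KrullDimLE 1 (MvPolynomial (Fin s) ℂ) := by
    have hA : Ring.KrullDimLE 1 A := Ring.krullDimLE_iff.2 hdim.le
    rw [Ring.krullDimLE_one_iff_of_isPrime_bot] at hA ⊢
    intro I hI hIp
    obtain ⟨Q, hQ, hQI⟩ := Ideal.exists_ideal_over_prime_of_isIntegral_of_isDomain (S := A) I (by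
      intro x hx
      have : x = 0 := hinj (by rw [map_zero]; exact hx)
      rw [this]; exact I.zero_mem)
    have hQ0 : Q ≠ ⊥ := by
      rintro rfl
      apply hI
      rw [← hQI]
      exact (RingHom.injective_iff_ker_eq_bot _).1 hinj
    have := hA Q hQ0 hQ
    rw [← hQI]
    exact Ideal.isMaximal_comap_of_isIntegral_of_isMaximal Q
  rw [Ring.krullDimLE_iff, MvPolynomial.ringKrullDim_of_isNoetherianRing,
    ringKrullDim_eq_zero_of_field, zero_add, Nat.card_eq_fintype_card, Fintype.card_fin] at hs1
  have hs1' : s ≤ 1 := by exact_mod_cast hs1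
  have hs0 : s ≠ 0 := by
    rintro rfl
    have h1 : IsField (MvPolynomial (Fin 0) ℂ) :=
      (MvPolynomial.isEmptyAlgEquiv ℂ (Fin 0)).toMulEquiv.isField (Field.toIsField ℂ)
    have h2 : IsField A := isField_of_isIntegral_of_isField' h1
    rw [ringKrullDim_eq_zero_of_isField h2] at hdim
    exact zero_ne_one hdim
  obtain rfl : s = 1 := by omega
  let e := MvPolynomial.uniqueAlgEquiv ℂ (Fin 1)
  have key : (aeval (g (e.symm X)) : ℂ[X] →ₐ[ℂ] A) = g.comp e.symm.toAlgHom := by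
    ext; simp
  refine ⟨g (e.symm X), ?_, ?_⟩
  · rw [key]
    exact hinj.comp e.symm.injective
  · rw [key]
    exact hfin.comp (AlgHom.Finite.of_surjective _ e.symm.surjective)

theorem exists_mul_pow_mem_adjoin {L : Type*} [CommRing L] [Algebra ℂ L] {s t : L} (hst : s * t = 1)
    {x : L} (hx : x ∈ Algebra.adjoin ℂ {t}) :
    ∃ D : ℕ, ∀ d ≥ D, x * s ^ d ∈ Algebra.adjoin ℂ {s} := by
  have hs : s ∈ Algebra.adjoin ℂ {s} := Algebra.self_mem_adjoin_singleton ℂ s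
  induction hx using Algebra.adjoin_induction with
  | mem x hx =>
    obtain rfl : x = t := hx
    refine ⟨1, fun d hd => ?_⟩
    obtain ⟨e, rfl⟩ := Nat.exists_eq_add_of_le hd
    rw [pow_add, pow_one, ← mul_assoc, mul_comm x, hst, one_mul]
    exact pow_mem hs _
  | algebraMap r => exact ⟨0, fun d _ => mul_mem (Subalgebra.algebraMap_mem _ r) (pow_mem hs _)⟩
  | add x y _ _ hx hy =>
    obtain ⟨D, hD⟩ := hx
    obtain ⟨E, hE⟩ := hy
    refine ⟨max D E, fun d hd => ?_⟩
    rw [add_mul]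
    exact add_mem (hD d (le_of_max_le_left hd)) (hE d (le_of_max_le_right hd))
  | mul x y _ _ hx hy =>
    obtain ⟨D, hD⟩ := hx
    obtain ⟨E, hE⟩ := hy
    refine ⟨D + E, fun d hd => ?_⟩
    obtain ⟨e, rfl⟩ := Nat.exists_eq_add_of_le hd
    rw [show x * y * s ^ (D + E + e) = (x * s ^ D) * (y * s ^ (E + e)) by ring]
    exact mul_mem (hD D le_rfl) (hE _ (by omega))

/-- Integrality over a subalgebra can be checked on a monic polynomial with coefficients in it. -/
theorem isIntegral_subalgebra_of_monic {L : Type*} [CommRing L] [Algebra ℂ L]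
    (S : Subalgebra ℂ L) {q : L[X]} (hq : q.Monic) (hc : ∀ i, q.coeff i ∈ S) {f : L}
    (hf : q.eval f = 0) : IsIntegral S f := by
  have hl : q ∈ lifts (algebraMap S L) := by
    rw [lifts_iff_coeff_lifts]
    exact fun i => ⟨⟨_, hc i⟩, rfl⟩
  obtain ⟨r, hr, -, hrm⟩ := lifts_and_natDegree_eq_and_monic hl hq
  exact ⟨r, hrm, by rw [← eval_map, hr, hf]⟩

theorem exists_isIntegral_mul_pow {L : Type*} [CommRing L] [Nontrivial L] [Algebra ℂ L] {s t : L}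
    (hst : s * t = 1) {f : L} (hf : IsIntegral (Algebra.adjoin ℂ {t}) f) :
    ∃ D : ℕ, ∀ d ≥ D, IsIntegral (Algebra.adjoin ℂ {s}) (f * s ^ d) := by
  obtain ⟨q, hq, hqf⟩ := hf
  choose D hD using fun i => exists_mul_pow_mem_adjoin hst (q.coeff i).2
  refine ⟨(Finset.range q.natDegree).sup D, fun d hd => ?_⟩
  have hdeg : (q.map (algebraMap _ L)).natDegree = q.natDegree := hq.natDegree_map _
  refine isIntegral_subalgebra_of_monic _
    (q := (q.map (algebraMap _ L)).scaleRoots (s ^ d)) ?_ ?_ ?_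
  · rw [monic_scaleRoots_iff]
    exact hq.map _
  · intro i
    rw [coeff_scaleRoots, hdeg, coeff_map]
    rcases lt_trichotomy i q.natDegree with hi | hi | hi
    · rw [← pow_mul]
      refine hD i _ ?_
      have h1 : D i ≤ d := (Finset.le_sup (Finset.mem_range.2 hi)).trans hd
      exact h1.trans (Nat.le_mul_of_pos_right _ (by omega))
    · subst hi
      have : q.coeff q.natDegree = 1 := hq
      rw [this]
      simp
    · rw [coeff_eq_zero_of_natDegree_lt hi]
      simp
  · rw [mul_comm]
    refine scaleRoots_eval₂_eq_zero (RingHom.id L) ?_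
    rw [eval₂_map]
    exact hqf

/-- The valuative criterion of integrality over the algebra generated by one element. -/
theorem isIntegral_adjoin_of_forall_valuationSubring {L K : Type*} [CommRing L] [Algebra ℂ L]
    [Field K] [Algebra L K] [Algebra ℂ K] [IsScalarTower ℂ L K] [FaithfulSMul L K] {v f : L}
    (h : ∀ V : ValuationSubring K, (∀ c : ℂ, algebraMap ℂ K c ∈ V) → algebraMap L K v ∈ V →
      algebraMap L K f ∈ V) : IsIntegral (Algebra.adjoin ℂ {v}) f := by
  set s : Set K := Set.range (algebraMap ℂ K) ∪ {algebraMap L K v} with hs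
  have h1 : algebraMap L K f ∈ (integralClosure (Subring.closure s) K).toSubring := by
    rw [← iInf_valuationSubring_superset]
    simp only [Subring.mem_iInf]
    rintro ⟨V, hV⟩
    exact h V (fun c => hV (Or.inl ⟨c, rfl⟩)) (hV (Or.inr rfl))
  obtain ⟨q, hq, hqf⟩ : IsIntegral (Subring.closure s) (algebraMap L K f) := h1
  have hl : q.map (algebraMap _ K) ∈ lifts (algebraMap (Algebra.adjoin ℂ {v}) K) := by
    rw [lifts_iff_coeff_lifts]
    intro i
    rw [coeff_map]
    have : Subring.closure s ≤ (algebraMap (Algebra.adjoin ℂ {v}) K).range := by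
      rw [Subring.closure_le]
      rintro x (⟨c, rfl⟩ | rfl)
      · refine ⟨algebraMap ℂ _ c, ?_⟩
        rw [IsScalarTower.algebraMap_apply ℂ L K]
        rfl
      · exact ⟨⟨v, Algebra.self_mem_adjoin_singleton ℂ v⟩, rfl⟩
    exact this (q.coeff i).2
  obtain ⟨r, hr, -, hrm⟩ := lifts_and_natDegree_eq_and_monic hl (hq.map _)
  refine ⟨r, hrm, FaithfulSMul.algebraMap_injective L K ?_⟩
  rw [map_zero, hom_eval₂, ← hqf, ← eval_map, ← eval_map (f := algebraMap (Subring.closure s) K),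
    ← hr]
  rfl

theorem algebraMap_polynomial_mem_adjoin {L : Type*} [CommRing L] [Algebra ℂ L]
    [Algebra ℂ[X] L] [IsScalarTower ℂ ℂ[X] L] (c : ℂ[X]) :
    algebraMap ℂ[X] L c ∈ Algebra.adjoin ℂ {algebraMap ℂ[X] L X} := by
  have : IsScalarTower.toAlgHom ℂ ℂ[X] L = aeval (algebraMap ℂ[X] L X) := by ext; simp
  have h := DFunLike.congr_fun this c
  simp only [IsScalarTower.coe_toAlgHom'] at h
  rw [h]
  exact aeval_mem_adjoin_singleton ℂ _

theorem algHom_algebraMap_polynomial {A : Type*} [CommRing A] [Algebra ℂ A]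
    [Algebra ℂ[X] A] [IsScalarTower ℂ ℂ[X] A] (φ : A →ₐ[ℂ] ℂ) (c : ℂ[X]) :
    φ (algebraMap ℂ[X] A c) = c.eval (φ (algebraMap ℂ[X] A X)) := by
  have : (φ.comp (IsScalarTower.toAlgHom ℂ ℂ[X] A)) = aeval (φ (algebraMap ℂ[X] A X)) := by
    ext; simp
  have h2 := DFunLike.congr_fun this c
  simpa [coe_aeval_eq_eval] using h2

theorem isIntegral_adjoin_algebraMap {A L : Type*} [CommRing A] [CommRing L] [Algebra ℂ A]
    [Algebra ℂ L] [Algebra ℂ[X] A] [IsScalarTower ℂ ℂ[X] A]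
    [Algebra.IsIntegral ℂ[X] A] [Algebra A L] [IsScalarTower ℂ A L] (x : A) :
    IsIntegral (Algebra.adjoin ℂ {algebraMap A L (algebraMap ℂ[X] A X)}) (algebraMap A L x) := by
  obtain ⟨q, hq, hqx⟩ := Algebra.IsIntegral.isIntegral (R := ℂ[X]) x
  refine isIntegral_subalgebra_of_monic _ (q := q.map ((algebraMap A L).comp (algebraMap ℂ[X] A)))
    (hq.map _) ?_ ?_
  · intro i
    rw [coeff_map]
    have h := algebraMap_polynomial_mem_adjoin (L := A) (q.coeff i)
    have h2 : IsScalarTower.toAlgHom ℂ A L (algebraMap ℂ[X] A (q.coeff i)) ∈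
        (Algebra.adjoin ℂ {algebraMap ℂ[X] A X}).map (IsScalarTower.toAlgHom ℂ A L) :=
      Subalgebra.mem_map.2 ⟨_, h, rfl⟩
    rw [AlgHom.map_adjoin_singleton] at h2
    exact h2
  · rw [eval_map, ← hom_eval₂, hqx, map_zero]

theorem exists_ne_zero_coeff_mul_eq_zero {ι : Type*} [Fintype ι] (ε : ι → ℂ[X]) {a D : ℕ}
    (ha : Fintype.card ι * D < a) :
    ∃ p : ℂ[X], p ≠ 0 ∧ p.degree < a ∧ ∀ j, ∀ i, i < a → a ≤ i + D → (p * ε j).coeff i = 0 := by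
  let F : degreeLT ℂ a →ₗ[ℂ] (ι × Fin D → ℂ) := LinearMap.pi fun jk =>
    (lcoeff ℂ (a - D + jk.2)) ∘ₗ (LinearMap.mulRight ℂ (ε jk.1)) ∘ₗ (degreeLT ℂ a).subtype
  have hker : LinearMap.ker F ≠ ⊥ := by
    have : Module.Finite ℂ (degreeLT ℂ a) := Module.Finite.equiv (degreeLTEquiv ℂ a).symm
    refine LinearMap.ker_ne_bot_of_finrank_lt ?_
    rw [(degreeLTEquiv ℂ a).finrank_eq]
    simpa using ha
  obtain ⟨p, hp, hp0⟩ := Submodule.exists_mem_ne_zero_of_ne_bot hker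
  refine ⟨p, by simpa using hp0, mem_degreeLT.1 p.2, fun j i hi hia => ?_⟩
  have h := congrFun (LinearMap.mem_ker.1 hp) (j, ⟨i - (a - D), by omega⟩)
  have h2 : a - D + (i - (a - D)) = i := by omega
  simpa [F, h2] using h

/-- A Hermite–Padé approximation producing a function with its only pole at a given point. -/
theorem exists_separating_function {A L : Type*} [CommRing A] [IsDomain A] [CommRing L]
    [Nontrivial L]
    [Algebra ℂ A] [Algebra ℂ L] [Algebra ℂ[X] A] [IsScalarTower ℂ ℂ[X] A] [Module.Finite ℂ[X] A]
    [FaithfulSMul ℂ[X] A] [Algebra A L] [IsScalarTower ℂ A L] {s : L}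
    (hs : s * algebraMap A L (algebraMap ℂ[X] A X) = 1) (φ : A →ₐ[ℂ] ℂ)
    (hφ : φ (algebraMap ℂ[X] A X) = 0) {u : A} (hu : φ u = 0) {N₀ : ℕ}
    (hN₀ : algebraMap ℂ[X] A X ∣ (u * (1 - u)) ^ N₀) :
    ∃ (a N : ℕ) (Q q : A), Q ≠ 0 ∧ u ^ N * Q = algebraMap ℂ[X] A X ^ a * q ∧
      IsIntegral (Algebra.adjoin ℂ {s})
        (algebraMap A L Q * s ^ a * algebraMap A L (algebraMap ℂ[X] A X)) := by
  set t := algebraMap ℂ[X] A X with ht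
  have ht0 : t ≠ 0 := by
    rw [ht, Ne, map_eq_zero_iff _ (FaithfulSMul.algebraMap_injective ℂ[X] A)]
    exact X_ne_zero
  obtain ⟨m, b, hb⟩ := Module.Finite.exists_fin (R := ℂ[X]) (M := A)
  obtain ⟨w, hw⟩ := hN₀
  have hD : ∀ j, ∃ D : ℕ, ∀ d ≥ D,
      IsIntegral (Algebra.adjoin ℂ {s}) (algebraMap A L (b j) * s ^ d) :=
    fun j => exists_isIntegral_mul_pow hs (isIntegral_adjoin_algebraMap (b j))
  choose D₁ hD₁ using hD
  obtain ⟨D, hDD⟩ : ∃ D, ∀ j, D₁ j ≤ D := ⟨Finset.univ.sup D₁, fun j => Finset.le_sup (by simp)⟩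
  set a := m * D + 1 with ha
  obtain ⟨ε, hε⟩ := (Submodule.mem_span_range_iff_exists_fun ℂ[X]).1
    (show (1 - u) ^ (N₀ * a) ∈ Submodule.span ℂ[X] (Set.range b) from hb ▸ Submodule.mem_top)
  obtain ⟨p, hp0, hpdeg, hp⟩ := exists_ne_zero_coeff_mul_eq_zero ε (a := a) (D := D)
    (by simp [ha])
  have hXm : (X ^ a : ℂ[X]).Monic := monic_X_pow a
  have hdivmod : ∀ j, algebraMap ℂ[X] A (p * ε j %ₘ X ^ a) =
      algebraMap ℂ[X] A (p * ε j) - t ^ a * algebraMap ℂ[X] A (p * ε j /ₘ X ^ a) := by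
    intro j
    have h := congrArg (algebraMap ℂ[X] A) (modByMonic_add_div (p * ε j) (X ^ a))
    rw [map_add, map_mul (algebraMap ℂ[X] A) (X ^ a), map_pow, ← ht] at h
    rw [← h]
    ring
  set r : A := ∑ j, algebraMap ℂ[X] A (p * ε j /ₘ X ^ a) * b j with hr
  set Q : A := ∑ j, algebraMap ℂ[X] A (p * ε j %ₘ X ^ a) * b j with hQ
  have hQe : Q = algebraMap ℂ[X] A p * (1 - u) ^ (N₀ * a) - t ^ a * r := by
    rw [← hε, hQ, hr, Finset.mul_sum, Finset.mul_sum, ← Finset.sum_sub_distrib]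
    refine Finset.sum_congr rfl fun j _ => ?_
    rw [hdivmod, Algebra.smul_def, map_mul]
    ring
  refine ⟨a, N₀ * a, Q, algebraMap ℂ[X] A p * w ^ a - u ^ (N₀ * a) * r, ?_, ?_, ?_⟩
  · intro hQ0
    rw [hQ0] at hQe
    obtain ⟨p', hp', hndvd⟩ := exists_eq_pow_rootMultiplicity_mul_and_not_dvd p hp0 0
    set i := p.rootMultiplicity 0
    rw [C_0, sub_zero] at hp' hndvd
    have hia : i < a := by
      have h1 : p'.natDegree + i = p.natDegree := by
        rw [hp', mul_comm, natDegree_mul_X_pow]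
        rintro rfl
        exact hndvd (dvd_zero _)
      have h2 := (natDegree_lt_iff_degree_lt hp0).2 hpdeg
      omega
    have h1 : t ^ i * (algebraMap ℂ[X] A p' * (1 - u) ^ (N₀ * a) - t ^ (a - i) * r) = 0 := by
      rw [hp', map_mul, map_pow, ← ht] at hQe
      have : t ^ a = t ^ i * t ^ (a - i) := by rw [← pow_add]; congr 1; omega
      rw [this] at hQe
      rw [hQe]; ring
    have h2 := (mul_eq_zero.1 h1).resolve_left (pow_ne_zero _ ht0)
    have h3 := congrArg φ h2
    simp only [map_sub, map_mul, map_pow, map_one, hu, sub_zero, one_pow, mul_one, hφ, map_zero,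
      zero_pow (show a - i ≠ 0 by omega), zero_mul] at h3
    rw [algHom_algebraMap_polynomial, ← ht, hφ] at h3
    exact hndvd (X_dvd_iff.2 (by rwa [coeff_zero_eq_eval_zero]))
  · rw [hQe]
    have : u ^ (N₀ * a) * (1 - u) ^ (N₀ * a) = t ^ a * w ^ a := by
      rw [← mul_pow, ← mul_pow, ← hw, pow_mul]
    linear_combination algebraMap ℂ[X] A p * this
  · rw [hQ, map_sum, Finset.sum_mul, Finset.sum_mul]
    refine IsIntegral.sum _ fun j _ => ?_
    rw [← Polynomial.sum_C_mul_X_pow_eq (p * ε j %ₘ X ^ a), Polynomial.sum, map_sum, Finset.sum_mul,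
      map_sum, Finset.sum_mul, Finset.sum_mul]
    refine IsIntegral.sum _ fun i hi => ?_
    have hi0 := mem_support_iff.1 hi
    have hia : i < a := by
      by_contra! h
      refine hi0 (coeff_eq_zero_of_degree_lt (lt_of_lt_of_le (degree_modByMonic_lt _ hXm) ?_))
      rw [degree_X_pow]; exact_mod_cast h
    have hcoe : (p * ε j %ₘ X ^ a).coeff i = (p * ε j).coeff i := by
      conv_rhs => rw [← modByMonic_add_div (p * ε j) (X ^ a)]
      rw [coeff_add, coeff_X_pow_mul', if_neg (by omega), add_zero]
    have hiD : i + D + 1 ≤ a := by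
      by_contra! h
      exact hi0 (hcoe.trans (hp j i hia (by omega)))
    obtain ⟨k, hk⟩ := Nat.exists_eq_add_of_le hiD
    have hsp : ∀ l : ℕ, s ^ l * algebraMap A L t ^ l = 1 := fun l => by
      rw [← mul_pow, hs, one_pow]
    have (c : ℂ) : algebraMap A L (algebraMap ℂ[X] A (C c * X ^ i) * b j) * s ^ a *
        algebraMap A L t = algebraMap ℂ L c * s ^ k * (algebraMap A L (b j) * s ^ D) := by
      rw [map_mul, map_mul (algebraMap ℂ[X] A), map_mul (algebraMap A L), map_pow, ← ht, map_pow,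
        ← algebraMap_eq,
        ← IsScalarTower.algebraMap_apply ℂ ℂ[X] A, ← IsScalarTower.algebraMap_apply ℂ A L, hk]
      linear_combination (algebraMap ℂ L c * s ^ k *
          (algebraMap A L (b j) * s ^ D)) * (hsp (i + 1))
    rw [this]
    refine IsIntegral.mul (IsIntegral.mul ?_ ?_) (hD₁ j D (hDD j))
    · exact isIntegral_algebraMap (x := algebraMap ℂ (Algebra.adjoin ℂ {s}) _)
    · exact IsIntegral.pow (isIntegral_algebraMap
        (x := (⟨s, Algebra.self_mem_adjoin_singleton ℂ s⟩ : Algebra.adjoin ℂ {s}))) _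

theorem algebraMap_mem_valuationSubring {L K : Type*} [CommRing L] [Algebra ℂ L]
    [Field K] [Algebra L K] [Algebra ℂ K] [IsScalarTower ℂ L K] {V : ValuationSubring K}
    (hV : ∀ c : ℂ, algebraMap ℂ K c ∈ V) {x f : L} (hx : algebraMap L K x ∈ V)
    (hf : IsIntegral (Algebra.adjoin ℂ {x}) f) : algebraMap L K f ∈ V := by
  have hle : ∀ y ∈ Algebra.adjoin ℂ {x}, algebraMap L K y ∈ V := by
    intro y hy
    induction hy using Algebra.adjoin_induction with
    | mem y hy => rw [Set.mem_singleton_iff.1 hy]; exact hx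
    | algebraMap r => rw [← IsScalarTower.algebraMap_apply]; exact hV r
    | add y z _ _ hy hz => rw [map_add]; exact add_mem hy hz
    | mul y z _ _ hy hz => rw [map_mul]; exact mul_mem hy hz
  let g : Algebra.adjoin ℂ {x} →+* V :=
    ((algebraMap L K).comp (algebraMap (Algebra.adjoin ℂ {x}) L)).codRestrict V.toSubring
      fun y => hle y y.2
  obtain ⟨q, hq, hqf⟩ := hf
  have : IsIntegral V (algebraMap L K f) := by
    refine ⟨q.map g, hq.map g, ?_⟩
    rw [eval₂_map]
    have h := congrArg (algebraMap L K) hqf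
    rw [map_zero, hom_eval₂] at h
    exact h
  obtain ⟨y, hy⟩ := IsIntegrallyClosed.isIntegral_iff.1 this
  rw [← hy]
  exact y.2

theorem isIntegral_adjoin_mul_pow {A L : Type*} [CommRing A] [CommRing L] [IsDomain L] [Algebra ℂ A]
    [Algebra ℂ L] [Algebra ℂ[X] A] [IsScalarTower ℂ ℂ[X] A]
    [Algebra.IsIntegral ℂ[X] A] [Algebra A L] [IsScalarTower ℂ A L] {s v : L}
    (hs : s * algebraMap A L (algebraMap ℂ[X] A X) = 1)
    (hv : IsIntegral (Algebra.adjoin ℂ {s}) (v * algebraMap A L (algebraMap ℂ[X] A X)))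
    {x : A} {D : ℕ} (hx : IsIntegral (Algebra.adjoin ℂ {s}) (algebraMap A L x * s ^ D)) :
    IsIntegral (Algebra.adjoin ℂ {v}) (algebraMap A L x * v ^ D) := by
  refine isIntegral_adjoin_of_forall_valuationSubring (K := FractionRing L) fun V hV hvV => ?_
  set t := algebraMap A L (algebraMap ℂ[X] A X) with ht
  rcases V.mem_or_inv_mem (algebraMap L (FractionRing L) t) with htV | htV
  · rw [map_mul, map_pow]
    exact mul_mem (algebraMap_mem_valuationSubring hV htV (isIntegral_adjoin_algebraMap x))
      (pow_mem hvV _)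
  · have hst : algebraMap L (FractionRing L) s = (algebraMap L (FractionRing L) t)⁻¹ := by
      refine eq_inv_of_mul_eq_one_left ?_
      rw [← map_mul, hs, map_one]
    rw [← hst] at htV
    have h1 := algebraMap_mem_valuationSubring hV htV hv
    have h2 := algebraMap_mem_valuationSubring hV htV hx
    have h3 : algebraMap A L x * v ^ D = algebraMap A L x * s ^ D * (v * t) ^ D := by
      have : s ^ D * t ^ D = 1 := by rw [← mul_pow, hs, one_pow]
      rw [mul_pow]
      linear_combination (- algebraMap A L x * v ^ D) * this
    rw [h3, map_mul, map_pow]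
    exact mul_mem h2 (pow_mem h1 _)

theorem mem_range_algebraMap_of_isIntegral {L : Type*} [CommRing L] [IsDomain L] [Algebra ℂ L]
    {x : L} (hx : IsIntegral ℂ x) : ∃ c : ℂ, algebraMap ℂ L c = x :=
  minpoly.mem_range_of_degree_eq_one ℂ x
    (IsAlgClosed.degree_eq_one_of_irreducible ℂ (minpoly.irreducible hx))

theorem aeval_injective_of_isIntegral {A L : Type*} [CommRing A] [CommRing L] [IsDomain L]
    [Algebra ℂ A]
    [Algebra ℂ L] [Algebra ℂ[X] A] [IsScalarTower ℂ ℂ[X] A] [FaithfulSMul ℂ[X] A]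
    [Algebra.IsIntegral ℂ[X] A] [Algebra A L] [FaithfulSMul A L] [IsScalarTower ℂ A L] {s v : L}
    (hs : s * algebraMap A L (algebraMap ℂ[X] A X) = 1) (hv0 : v ≠ 0)
    (hv : IsIntegral (Algebra.adjoin ℂ {s}) (v * algebraMap A L (algebraMap ℂ[X] A X))) :
    Function.Injective (aeval v : ℂ[X] →ₐ[ℂ] L) := by
  by_contra hinj
  have halg : IsIntegral ℂ v := by
    rw [← transcendental_iff_injective] at hinj
    exact (not_not.1 hinj : IsAlgebraic ℂ v).isIntegral
  have h1 : IsIntegral (Algebra.adjoin ℂ {v})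
      (algebraMap A L (algebraMap ℂ[X] A X) * v ^ 1) := by
    refine isIntegral_adjoin_mul_pow hs hv ?_
    rw [pow_one, mul_comm, hs]
    exact isIntegral_one
  have : Algebra.IsIntegral ℂ (Algebra.adjoin ℂ {v}) := 
    Algebra.IsIntegral.adjoin (by simpa using halg)
  obtain ⟨c, hc⟩ := mem_range_algebraMap_of_isIntegral halg
  obtain ⟨c', hc'⟩ := mem_range_algebraMap_of_isIntegral (isIntegral_trans (R := ℂ) _ h1)
  have hc0 : c ≠ 0 := by
    rintro rfl
    exact hv0 (by rw [← hc, map_zero])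
  have h2 : algebraMap A L (algebraMap ℂ[X] A (X * C c - C c')) = 0 := by
    rw [map_sub, map_mul, map_sub, map_mul, ← algebraMap_eq,
      ← IsScalarTower.algebraMap_apply ℂ ℂ[X] A, ← IsScalarTower.algebraMap_apply ℂ ℂ[X] A, 
      ← IsScalarTower.algebraMap_apply ℂ A L, ← IsScalarTower.algebraMap_apply ℂ A L, hc, hc']
    ring
  rw [map_eq_zero_iff _ (FaithfulSMul.algebraMap_injective A L),
    map_eq_zero_iff _ (FaithfulSMul.algebraMap_injective ℂ[X] A)] at h2
  have h3 := congrArg (fun q => q.coeff 1) h2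
  simp [coeff_C] at h3
  exact hc0 h3

theorem exists_norm_le_of_isIntegral_adjoin {L ι : Type*} [Finite ι] [CommRing L] [IsDomain L]
    [Algebra ℂ L] {v : L} (hv : Function.Injective (aeval v : ℂ[X] →ₐ[ℂ] L)) {x : ι → L}
    (hx : ∀ i, IsIntegral (Algebra.adjoin ℂ {v}) (x i)) :
    ∃ (B : Subalgebra ℂ L) (w : B) (y : ι → B), (w : L) = v ∧ (∀ i, (y i : L) = x i) ∧
      ∃ c : ℝ, 1 ≤ c ∧ ∀ (h : B) (ρ H : ℝ), 0 < ρ → 0 ≤ H →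
      (∀ φ : B →ₐ[ℂ] ℂ, ‖φ w‖ = ρ → ‖φ h‖ ≤ H) → ∀ φ : B →ₐ[ℂ] ℂ, ‖φ w‖ ≤ ρ → ‖φ h‖ ≤ c * H := by
  set S : Set L := insert v (Set.range x) with hS
  let B := Algebra.adjoin ℂ S
  have hvS : v ∈ B := Algebra.subset_adjoin (Set.mem_insert _ _)
  have hxS : ∀ i, x i ∈ B := fun i => Algebra.subset_adjoin (Set.mem_insert_of_mem _ ⟨i, rfl⟩)
  have hBint : ∀ f ∈ B, IsIntegral (Algebra.adjoin ℂ {v}) f := by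
    have : B ≤ (integralClosure (Algebra.adjoin ℂ {v}) L).restrictScalars ℂ := by
      refine Algebra.adjoin_le ?_
      rintro f (rfl | ⟨i, rfl⟩)
      · exact isIntegral_algebraMap
          (x := (⟨f, Algebra.self_mem_adjoin_singleton ℂ f⟩ : Algebra.adjoin ℂ {f}))
      · exact hx i
    exact fun f hf => this hf
  let w : B := ⟨v, hvS⟩
  let _ : Algebra ℂ[X] B := (aeval w : ℂ[X] →ₐ[ℂ] B).toAlgebra
  have hmap : ∀ c : ℂ[X], ((algebraMap ℂ[X] B c : B) : L) = aeval v c := fun c =>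
    (aeval_algHom_apply B.val w c).symm
  have : IsScalarTower ℂ ℂ[X] B := IsScalarTower.of_algebraMap_eq fun c => by
    exact ((aeval w : ℂ[X] →ₐ[ℂ] B).commutes c).symm
  have : FaithfulSMul ℂ[X] B := by
    rw [faithfulSMul_iff_algebraMap_injective]
    intro c d hcd
    exact hv (by rw [← hmap, ← hmap, hcd])
  have : Algebra.FiniteType ℂ B :=
    (Subalgebra.fg_iff_finiteType B).1 (Subalgebra.fg_def.2
      ⟨S, (Set.finite_range x).insert v, rfl⟩)
  have : Algebra.FiniteType ℂ[X] B := Algebra.FiniteType.of_restrictScalars_finiteType ℂ ℂ[X] B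
  have : Algebra.IsIntegral ℂ[X] B := by
    refine ⟨fun f => ?_⟩
    obtain ⟨q, hq, hqf⟩ := hBint f f.2
    have hl : q.map (algebraMap _ L) ∈ lifts ((aeval v : ℂ[X] →ₐ[ℂ] L) : ℂ[X] →+* L) := by
      rw [lifts_iff_coeff_lifts]
      intro i
      rw [coeff_map]
      exact (Algebra.adjoin_singleton_eq_range_aeval ℂ v).le (q.coeff i).2
    obtain ⟨r, hr, -, hrm⟩ := lifts_and_natDegree_eq_and_monic hl (hq.map _)
    refine ⟨r, hrm, Subtype.ext ?_⟩
    have h1 : B.val (eval₂ (algebraMap ℂ[X] B) f r) = 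
        eval₂ (((aeval v : ℂ[X] →ₐ[ℂ] L) : ℂ[X] →+* L)) (f : L) r := by
      refine (hom_eval₂ r (algebraMap ℂ[X] B) (B.val : B →+* L) f).trans ?_
      congr 1
      exact RingHom.ext hmap
    refine h1.trans ?_
    rw [← eval_map, hr, eval_map]
    exact hqf
  have : Module.Finite ℂ[X] B := Algebra.IsIntegral.finite
  have hw : algebraMap ℂ[X] B X = w := aeval_X w
  refine ⟨B, w, fun i => ⟨x i, hxS i⟩, rfl, fun i => rfl, ?_⟩
  have := exists_norm_le_of_norm_le_on_circle B
  rwa [hw] at this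

theorem prod_mul_pow_mul_pow {R ι : Type*} [CommRing R] (x : ι → R) (v : R) (k e : ℕ)
    (m : ι →₀ ℕ) : (∏ i ∈ m.support, (x i * v ^ k) ^ m i) * v ^ (k * e) =
      v ^ (k * (m.degree + e)) * ∏ i ∈ m.support, x i ^ m i := by
  have : ∏ i ∈ m.support, (x i * v ^ k) ^ m i =
      (∏ i ∈ m.support, x i ^ m i) * v ^ (k * m.degree) := by
    rw [Finsupp.degree_apply, pow_mul, ← Finset.prod_pow_eq_pow_sum, ← Finset.prod_mul_distrib]
    exact Finset.prod_congr rfl fun i _ => mul_pow _ _ _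
  rw [this]
  ring

theorem exists_homogenization {L ι : Type*} [CommRing L] [Algebra ℂ L]
    {B : Subalgebra ℂ L} {w : B} {y : ι → B} {x : ι → L} {k : ℕ}
    (hy : ∀ i, (y i : L) = x i * (w : L) ^ k) (F : MvPolynomial ι ℂ) {d : ℕ}
    (hd : F.totalDegree ≤ d) :
    ∃ b : B, (b : L) = (w : L) ^ (k * d) * MvPolynomial.aeval x F ∧
      ∀ φ : B →ₐ[ℂ] ℂ, φ w ≠ 0 →
        φ b = φ w ^ (k * d) * MvPolynomial.eval (fun i => φ (y i) / φ w ^ k) F := by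
  have hm : ∀ m ∈ F.support, ∃ e, d = m.degree + e := fun m hm =>
    Nat.exists_eq_add_of_le ((MvPolynomial.le_totalDegree hm).trans hd)
  refine ⟨∑ m ∈ F.support, algebraMap ℂ B (F.coeff m) * ((∏ i ∈ m.support, y i ^ m i) *
    w ^ (k * (d - m.degree))), ?_, ?_⟩
  · have : ((w : L) ^ (k * d) * MvPolynomial.aeval x F) = ∑ m ∈ F.support,
        algebraMap ℂ L (F.coeff m) * ((w : L) ^ (k * d) * ∏ i ∈ m.support, x i ^ m i) := by
      rw [MvPolynomial.aeval_def, MvPolynomial.eval₂_eq, Finset.mul_sum]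
      exact Finset.sum_congr rfl fun m _ => by ring
    rw [this, AddSubmonoidClass.coe_finsetSum]
    refine Finset.sum_congr rfl fun m hms => ?_
    obtain ⟨e, he⟩ := hm m hms
    have h1 := prod_mul_pow_mul_pow x (w : L) k e m
    simp only [← hy] at h1
    rw [he, ← h1, Nat.add_sub_cancel_left]
    simp
  · intro φ hφ
    rw [map_sum, MvPolynomial.eval_eq, Finset.mul_sum]
    refine Finset.sum_congr rfl fun m hms => ?_
    obtain ⟨e, he⟩ := hm m hms
    have h1 := prod_mul_pow_mul_pow (fun i => φ (y i) / φ w ^ k) (φ w) k e m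
    simp only [div_mul_cancel₀ _ (pow_ne_zero k hφ)] at h1
    rw [mul_left_comm (φ w ^ _), he, ← h1, Nat.add_sub_cancel_left]
    simp

theorem exists_bound_of_isIntegral_adjoin {L : Type*} [CommRing L] [Algebra ℂ L] {s f : L}
    (hf : IsIntegral (Algebra.adjoin ℂ {s}) f) (ρ : ℝ) :
    ∃ M : ℝ, ∀ φ : L →ₐ[ℂ] ℂ, ‖φ s‖ ≤ ρ → ‖φ f‖ ≤ M := by
  have hc : ∀ c : Algebra.adjoin ℂ {s}, ∃ M : NNReal, ∀ φ : L →ₐ[ℂ] ℂ, ‖φ s‖ ≤ ρ →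
      ‖φ (c : L)‖₊ ≤ M := by
    rintro ⟨c, hc⟩
    obtain ⟨q, rfl⟩ := (Algebra.adjoin_singleton_eq_range_aeval ℂ s).le hc
    obtain ⟨M, hM⟩ := (isCompact_closedBall (0 : ℂ) ρ).exists_bound_of_continuousOn
      q.continuous.continuousOn
    refine ⟨M.toNNReal, fun φ hφ => ?_⟩
    refine NNReal.le_toNNReal_of_coe_le ?_
    have h := hM (φ s) (by simpa using hφ)
    rw [← coe_aeval_eq_eval, aeval_algHom_apply] at h
    exact h
  obtain ⟨q, hq, hqf⟩ := hf
  choose M hM using hc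
  refine ⟨(((Finset.range q.natDegree).sup fun i => M (q.coeff i)) + 1 : NNReal), fun φ hφ => ?_⟩
  let g : Algebra.adjoin ℂ {s} →+* ℂ := (φ : L →+* ℂ).comp (algebraMap _ L)
  have hroot : (q.map g).IsRoot (φ f) := by
    rw [IsRoot, eval_map]
    have h := congrArg φ hqf
    rw [map_zero] at h
    exact (hom_eval₂ q _ (φ : L →+* ℂ) f).symm.trans h
  have h1 := IsRoot.norm_lt_cauchyBound (hq.map g).ne_zero hroot
  rw [cauchyBound, (hq.map g).leadingCoeff, hq.natDegree_map, nnnorm_one, div_one] at h1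
  refine NNReal.coe_le_coe.2 (h1.le.trans ?_)
  refine add_le_add_left (Finset.sup_mono_fun fun i _ => ?_) 1
  rw [coeff_map]
  exact hM _ φ hφ

theorem exists_dvd_pow_of_forall_algHom {A : Type*} [CommRing A] [Algebra ℂ A]
    [Algebra.FiniteType ℂ A] {t f : A} (h : ∀ φ : A →ₐ[ℂ] ℂ, φ t = 0 → φ f = 0) :
    ∃ N : ℕ, t ∣ f ^ N := by
  have : IsJacobsonRing A := isJacobsonRing_of_finiteType (A := ℂ)
  suffices f ∈ (Ideal.span {t}).radical by
    obtain ⟨N, hN⟩ := this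
    exact ⟨N, Ideal.mem_span_singleton.1 hN⟩
  rw [Ideal.radical_eq_jacobson, Ideal.jacobson, Ideal.mem_sInf]
  rintro M ⟨htM, hM⟩
  obtain ⟨φ, hφ⟩ := exists_algHom_complex_of_ne_top hM.ne_top
  have hker : M = RingHom.ker φ :=
    hM.eq_of_le (RingHom.ker_ne_top φ) fun b hb => hφ b hb
  rw [hker]
  exact h φ (hφ t (htM (Ideal.mem_span_singleton_self t)))

theorem algHom_aeval_eq_eval {A ι : Type*} [CommRing A] [Algebra ℂ A] (x : ι → A)
    (φ : A →ₐ[ℂ] ℂ) (F : MvPolynomial ι ℂ) :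
    φ (MvPolynomial.aeval x F) = MvPolynomial.eval (fun i => φ (x i)) F := by
  rw [MvPolynomial.comp_aeval_apply]
  exact DFunLike.congr_fun (MvPolynomial.coe_aeval_eq_eval _) F

theorem exists_algHom_of_eval_eq_zero {A ι : Type*} [CommRing A] [Algebra ℂ A] {x : ι → A}
    (hx : Function.Surjective (MvPolynomial.aeval x : MvPolynomial ι ℂ →ₐ[ℂ] A)) {z : ι → ℂ}
    (hz : ∀ F : MvPolynomial ι ℂ, MvPolynomial.aeval x F = 0 → MvPolynomial.eval z F = 0) :
    ∃ φ : A →ₐ[ℂ] ℂ, ∀ i, φ (x i) = z i := by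
  refine ⟨AlgHom.liftOfSurjective _ hx (MvPolynomial.aeval z) fun F hF => ?_, fun i => ?_⟩
  · exact (DFunLike.congr_fun (MvPolynomial.coe_aeval_eq_eval z) F).trans (hz F hF)
  · have := AlgHom.liftOfSurjective_apply (MvPolynomial.aeval x) hx (MvPolynomial.aeval z) 
      (fun F hF => (DFunLike.congr_fun (MvPolynomial.coe_aeval_eq_eval z) F).trans (hz F hF))
      (MvPolynomial.X i)
    simpa using this

theorem algHom_ext_of_surjective {A ι : Type*} [CommRing A] [Algebra ℂ A] {x : ι → A}
    (hx : Function.Surjective (MvPolynomial.aeval x : MvPolynomial ι ℂ →ₐ[ℂ] A))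
    {φ ψ : A →ₐ[ℂ] ℂ} (h : ∀ i, φ (x i) = ψ (x i)) : φ = ψ := by
  ext f
  obtain ⟨F, rfl⟩ := hx f
  rw [algHom_aeval_eq_eval, algHom_aeval_eq_eval, funext h]

section Compact

variable {A ι : Type*} [Finite ι] [CommRing A] [Algebra ℂ A] [Algebra ℂ[X] A]
  [IsScalarTower ℂ ℂ[X] A] [Algebra.IsIntegral ℂ[X] A] {x : ι → A}

theorem exists_bound_of_norm_le (f : A) (ρ : ℝ) :
    ∃ M : ℝ, ∀ φ : A →ₐ[ℂ] ℂ, ‖φ (algebraMap ℂ[X] A X)‖ ≤ ρ → ‖φ f‖ ≤ M :=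
  exists_bound_of_isIntegral_adjoin (isIntegral_adjoin_algebraMap (L := A) f) ρ

theorem isCompact_setOf_norm_le
    (hx : Function.Surjective (MvPolynomial.aeval x : MvPolynomial ι ℂ →ₐ[ℂ] A)) (ρ : ℝ) :
    IsCompact {z : ι → ℂ | ∃ φ : A →ₐ[ℂ] ℂ, (∀ i, φ (x i) = z i) ∧
      ‖φ (algebraMap ℂ[X] A X)‖ ≤ ρ} := by
  have := Fintype.ofFinite ι
  obtain ⟨T, hT⟩ := hx (algebraMap ℂ[X] A X)
  choose M hM using fun i => exists_bound_of_norm_le (x i) ρ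
  refine (isCompact_univ_pi fun i => isCompact_closedBall (0 : ℂ) (M i)).of_isClosed_subset ?_ ?_
  · have : {z : ι → ℂ | ∃ φ : A →ₐ[ℂ] ℂ, (∀ i, φ (x i) = z i) ∧
        ‖φ (algebraMap ℂ[X] A X)‖ ≤ ρ} =
        (⋂ F ∈ {F : MvPolynomial ι ℂ | MvPolynomial.aeval x F = 0},
          {z | MvPolynomial.eval z F = 0}) ∩ {z | ‖MvPolynomial.eval z T‖ ≤ ρ} := by
      ext z
      simp only [Set.mem_ofPred_eq, Set.mem_inter_iff, Set.mem_iInter]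
      constructor
      · rintro ⟨φ, hφ, hρ⟩
        obtain rfl : (fun i => φ (x i)) = z := funext hφ
        rw [← hT, algHom_aeval_eq_eval] at hρ
        refine ⟨fun F hF => ?_, hρ⟩
        rw [← algHom_aeval_eq_eval, hF, map_zero]
      · rintro ⟨h1, h2⟩
        obtain ⟨φ, hφ⟩ := exists_algHom_of_eval_eq_zero hx h1
        refine ⟨φ, hφ, ?_⟩
        rwa [← hT, algHom_aeval_eq_eval, funext hφ]
    rw [this]
    refine IsClosed.inter (isClosed_biInter fun F _ => ?_) ?_
    · exact isClosed_eq (MvPolynomial.continuous_eval F) continuous_const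
    · exact isClosed_le (MvPolynomial.continuous_eval T).norm continuous_const
  · rintro z ⟨φ, hφ, hρ⟩ i -
    rw [← hφ]
    simpa using hM i φ hρ

theorem finite_setOf_algHom_eq
    (hx : Function.Surjective (MvPolynomial.aeval x : MvPolynomial ι ℂ →ₐ[ℂ] A)) (τ : ℂ) :
    {φ : A →ₐ[ℂ] ℂ | φ (algebraMap ℂ[X] A X) = τ}.Finite := by
  have h1 : ∀ i, {c : ℂ | ∃ φ : A →ₐ[ℂ] ℂ, φ (algebraMap ℂ[X] A X) = τ ∧ φ (x i) = c}.Finite := by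
    intro i
    obtain ⟨q, hq, hqx⟩ := Algebra.IsIntegral.isIntegral (R := ℂ[X]) (x i)
    refine ((q.map (evalRingHom τ)).roots.toFinset.finite_toSet).subset ?_
    rintro c ⟨φ, hφ, rfl⟩
    simp only [Finset.mem_coe, Multiset.mem_toFinset]
    rw [mem_roots (hq.map _).ne_zero, IsRoot, eval_map]
    have h := congrArg φ hqx
    rw [map_zero] at h
    refine Eq.trans ?_ ((hom_eval₂ q _ (φ : A →+* ℂ) (x i)).symm.trans h)
    congr 1
    exact RingHom.ext fun c => by simpa [hφ] using (algHom_algebraMap_polynomial φ c).symm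
  refine Set.Finite.of_finite_image (f := fun φ i => φ (x i)) ?_ ?_
  · refine (Set.Finite.pi h1).subset ?_
    rintro _ ⟨φ, hφ, rfl⟩ i -
    exact ⟨φ, hφ, rfl⟩
  · intro φ _ ψ _ h
    exact algHom_ext_of_surjective hx (congrFun h)

/-- An idempotent-like function separating a point of a fibre from the other ones. -/
theorem exists_separating_point
    (hx : Function.Surjective (MvPolynomial.aeval x : MvPolynomial ι ℂ →ₐ[ℂ] A)) (φ₀ : A →ₐ[ℂ] ℂ) :
    ∃ u : A, φ₀ u = 0 ∧ ∀ φ : A →ₐ[ℂ] ℂ,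
      φ (algebraMap ℂ[X] A X) = φ₀ (algebraMap ℂ[X] A X) → φ ≠ φ₀ → φ u = 1 := by
  classical
  have hfin := finite_setOf_algHom_eq hx (φ₀ (algebraMap ℂ[X] A X))
  have hl : ∀ φ : A →ₐ[ℂ] ℂ, ∃ l : A, φ₀ l = 1 ∧ (φ ≠ φ₀ → φ l = 0) := by
    intro φ
    by_cases h : φ = φ₀
    · exact ⟨1, map_one _, fun h' => absurd h h'⟩
    · obtain ⟨i, hi⟩ : ∃ i, φ (x i) ≠ φ₀ (x i) := by
        by_contra! h'
        exact h (algHom_ext_of_surjective hx h')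
      refine ⟨(φ₀ (x i) - φ (x i))⁻¹ • (x i - algebraMap ℂ A (φ (x i))), ?_, fun _ => ?_⟩
      · simp [inv_mul_cancel₀ (sub_ne_zero.2 (Ne.symm hi))]
      · simp
  choose l hl1 hl2 using hl
  refine ⟨1 - ∏ φ ∈ hfin.toFinset, l φ, ?_, fun φ hφ hne => ?_⟩
  · simp [map_prod, hl1]
  · rw [map_sub, map_one, map_prod, Finset.prod_eq_zero (i := φ) (by simpa using hφ) (hl2 φ hne),
      sub_zero]

end Compact

theorem exists_algHom_extending_away {A L : Type*} [CommRing A] [CommRing L] [Algebra ℂ A]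
    [Algebra ℂ L] [Algebra A L] [IsScalarTower ℂ A L] {t : A} [IsLocalization.Away t L]
    {φ : A →ₐ[ℂ] ℂ} (hφ : φ t ≠ 0) :
    ∃ ψ : L →ₐ[ℂ] ℂ, ∀ f, ψ (algebraMap A L f) = φ f := by
  refine ⟨IsLocalization.liftAlgHom (M := Submonoid.powers t) (f := φ) ?_, fun f => ?_⟩
  · rintro ⟨_, k, rfl⟩
    simpa using IsUnit.pow k (isUnit_iff_ne_zero.2 hφ)
  · simp

section Pole

variable {A L ι : Type*} [Finite ι] [CommRing A] [CommRing L] [Algebra ℂ A]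
  [Algebra ℂ L] [Algebra ℂ[X] A] [IsScalarTower ℂ ℂ[X] A]
  [Algebra.IsIntegral ℂ[X] A] [Algebra A L] [IsScalarTower ℂ A L]
  [IsLocalization.Away (algebraMap ℂ[X] A X) L] {x : ι → A} {s : L}

/-- Points where a function with a single pole takes large values are close to the pole. -/
theorem exists_mem_of_le_norm
    (hx : Function.Surjective (MvPolynomial.aeval x : MvPolynomial ι ℂ →ₐ[ℂ] A))
    (hs : s * algebraMap A L (algebraMap ℂ[X] A X) = 1) {φ₀ : A →ₐ[ℂ] ℂ} {u Q q : A} {a N : ℕ}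
    (hu : ∀ φ : A →ₐ[ℂ] ℂ, φ (algebraMap ℂ[X] A X) = 0 → φ u = 0 → φ = φ₀)
    (hint : IsIntegral (Algebra.adjoin ℂ {s})
      (algebraMap A L Q * s ^ a * algebraMap A L (algebraMap ℂ[X] A X)))
    {U : Set (ι → ℂ)} (hU : IsOpen U) (hφ₀ : (fun i => φ₀ (x i)) ∈ U) :
    ∃ R : ℝ, 0 < R ∧ ∀ (φ : A →ₐ[ℂ] ℂ) (τ : ℂ), φ Q = τ * φ (algebraMap ℂ[X] A X) ^ a →
      φ u ^ N * τ = φ q → R ≤ ‖τ‖ → (fun i => φ (x i)) ∈ U := by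
  set t := algebraMap ℂ[X] A X with ht
  obtain ⟨M₁, hM₁⟩ := exists_bound_of_isIntegral_adjoin hint 1
  obtain ⟨M₂, hM₂⟩ := exists_bound_of_norm_le Q 1
  obtain ⟨M₃, hM₃⟩ := exists_bound_of_norm_le q 1
  obtain ⟨T, hT⟩ := hx t
  obtain ⟨G, hG⟩ := hx u
  have hK := (isCompact_setOf_norm_le hx 1).diff hU
  obtain ⟨ε, hε, hKε⟩ := hK.exists_forall_le' (a := (0 : ℝ))
    (f := fun z => ‖MvPolynomial.eval z T‖ ^ a + ‖MvPolynomial.eval z G‖ ^ N)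
    ((((MvPolynomial.continuous_eval T).norm.pow a).add
      ((MvPolynomial.continuous_eval G).norm.pow N)).continuousOn) (by
      rintro z ⟨⟨φ, hφ, -⟩, hzU⟩
      obtain rfl : (fun i => φ (x i)) = z := funext hφ
      simp only [← algHom_aeval_eq_eval, hT, hG]
      by_contra! hle
      have h1 : ‖φ t‖ ^ a = 0 := by
        have := pow_nonneg (norm_nonneg (φ t)) a
        have := pow_nonneg (norm_nonneg (φ u)) N
        linarith
      have h2 : ‖φ u‖ ^ N = 0 := by
        have := pow_nonneg (norm_nonneg (φ t)) a
        have := pow_nonneg (norm_nonneg (φ u)) N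
        linarith
      refine hzU ?_
      rw [hu φ (norm_eq_zero.1 (eq_zero_of_pow_eq_zero h1))
        (norm_eq_zero.1 (eq_zero_of_pow_eq_zero h2))]
      exact hφ₀)
  refine ⟨max 0 (max M₁ ((M₂ + M₃) / ε)) + 1, by positivity, fun φ τ hQ hq hR => ?_⟩
  obtain ⟨-, hR1, hR2⟩ : 0 < ‖τ‖ ∧ M₁ < ‖τ‖ ∧ (M₂ + M₃) / ε < ‖τ‖ := by
    rw [← max_lt_iff, ← max_lt_iff]
    exact (lt_add_one _).trans_le hR
  have ht1 : ‖φ t‖ < 1 := by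
    by_contra! h1
    have hφt : φ t ≠ 0 := fun h => by rw [h, norm_zero] at h1; linarith
    obtain ⟨ψ, hψ⟩ := exists_algHom_extending_away (L := L) hφt
    have hst : ψ s * φ t = 1 := by rw [← hψ, ← map_mul, hs, map_one]
    have hsn : ‖ψ s‖ * ‖φ t‖ = 1 := by rw [← norm_mul, hst, norm_one]
    have h2 := hM₁ ψ (by nlinarith [norm_nonneg (ψ s)])
    have h3 : ψ (algebraMap A L Q * s ^ a * algebraMap A L t) = τ * φ t := by
      have : ψ s ^ a * φ t ^ a = 1 := by rw [← mul_pow, hst, one_pow]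
      rw [map_mul, map_mul, map_pow, hψ, hψ, hQ]
      linear_combination τ * φ t * this
    rw [h3, norm_mul] at h2
    nlinarith [norm_nonneg τ]
  by_contra hU'
  have h1 := hKε _ ⟨⟨φ, fun i => rfl, ht1.le⟩, hU'⟩
  simp only [← algHom_aeval_eq_eval, hT, hG] at h1
  have h2 : ‖τ‖ * (‖φ t‖ ^ a + ‖φ u‖ ^ N) ≤ M₂ + M₃ := by
    have h3 := hM₂ φ ht1.le
    have h4 := hM₃ φ ht1.le
    rw [hQ, norm_mul, norm_pow] at h3
    rw [← hq, norm_mul, norm_pow] at h4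
    linarith
  rw [div_lt_iff₀ hε] at hR2
  nlinarith [norm_nonneg τ]

end Pole

theorem exists_algHom_of_homogeneous {A L ι : Type*} [CommRing A] [CommRing L] [Algebra ℂ A]
    [Algebra ℂ L] [Algebra A L] [IsScalarTower ℂ A L] {x : ι → A}
    (hx : Function.Surjective (MvPolynomial.aeval x : MvPolynomial ι ℂ →ₐ[ℂ] A))
    {B : Subalgebra ℂ L} {w : B} {y : ι → B} {k : ℕ}
    (hy : ∀ i, (y i : L) = algebraMap A L (x i) * (w : L) ^ k) {φ : B →ₐ[ℂ] ℂ} (hφ : φ w ≠ 0) :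
    ∃ χ : A →ₐ[ℂ] ℂ,
      (∀ (F : MvPolynomial ι ℂ) (d : ℕ), F.totalDegree ≤ d → ∀ b : B,
        (b : L) = (w : L) ^ (k * d) * algebraMap A L (MvPolynomial.aeval x F) →
          φ b = φ w ^ (k * d) * χ (MvPolynomial.aeval x F)) ∧
      ∀ f g : A, (w : L) * algebraMap A L f = algebraMap A L g → φ w * χ f = χ g := by
  have hxL : ∀ F : MvPolynomial ι ℂ, MvPolynomial.aeval (fun i => algebraMap A L (x i)) F =
      algebraMap A L (MvPolynomial.aeval x F) := fun F =>
    (MvPolynomial.comp_aeval_apply x (IsScalarTower.toAlgHom ℂ A L) F).symm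
  have hhom : ∀ (F : MvPolynomial ι ℂ) (d : ℕ), F.totalDegree ≤ d → ∀ b : B,
        (b : L) = (w : L) ^ (k * d) * algebraMap A L (MvPolynomial.aeval x F) →
          φ b = φ w ^ (k * d) * MvPolynomial.eval (fun i => φ (y i) / φ w ^ k) F := by
    intro F d hd b hb
    obtain ⟨b', hb', hφb'⟩ := exists_homogenization hy F hd
    rw [hxL, ← hb] at hb'
    rw [← Subtype.ext hb']
    exact hφb' φ hφ
  obtain ⟨χ, hχ⟩ := exists_algHom_of_eval_eq_zero hx (z := fun i => φ (y i) / φ w ^ k) (by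
    intro F hF
    have h := hhom F _ le_rfl 0 (by rw [hF]; simp)
    rw [map_zero, eq_comm, mul_eq_zero] at h
    exact h.resolve_left (pow_ne_zero _ hφ))
  have hχe : ∀ F, χ (MvPolynomial.aeval x F) =
      MvPolynomial.eval (fun i => φ (y i) / φ w ^ k) F := fun F => by
    rw [algHom_aeval_eq_eval, funext hχ]
  refine ⟨χ, fun F d hd b hb => by rw [hχe]; exact hhom F d hd b hb, fun f g hfg => ?_⟩
  obtain ⟨F, rfl⟩ := hx f
  obtain ⟨G, rfl⟩ := hx g
  set d := max F.totalDegree G.totalDegree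
  obtain ⟨b, hb, hφb⟩ := exists_homogenization hy F (le_max_left _ _ : _ ≤ d)
  obtain ⟨b', hb', hφb'⟩ := exists_homogenization hy G (le_max_right _ _ : _ ≤ d)
  have hbb : w * b = b' := Subtype.ext (by
    rw [hb', MulMemClass.coe_mul, hb, hxL, hxL, ← hfg]; ring)
  have h := congrArg φ hbb
  rw [map_mul, hφb φ hφ, hφb' φ hφ] at h
  rw [hχe, hχe]
  refine mul_left_cancel₀ (pow_ne_zero (k * d) hφ) ?_
  linear_combination h

theorem exists_le_norm_on_circle {A ι : Type*} [Finite ι] [CommRing A] [IsDomain A] [Algebra ℂ A]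
    [Algebra ℂ[X] A] [IsScalarTower ℂ ℂ[X] A] [Algebra.IsIntegral ℂ[X] A] {x : ι → A}
    (hx : Function.Surjective (MvPolynomial.aeval x : MvPolynomial ι ℂ →ₐ[ℂ] A)) {Q : A}
    (hQ : Q ≠ 0) (ρ₀ : ℝ) :
    ∃ ρ ε : ℝ, ρ₀ ≤ ρ ∧ 0 < ρ ∧ 0 < ε ∧ ∀ φ : A →ₐ[ℂ] ℂ, ‖φ (algebraMap ℂ[X] A X)‖ = ρ →
      ε ≤ ‖φ Q‖ := by
  have halg : IsAlgebraic ℂ[X] Q := by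
    have : Nontrivial ℂ[X] := inferInstance
    exact (Algebra.IsIntegral.isIntegral Q).isAlgebraic
  obtain ⟨r, hr0, Q', hQ'⟩ := halg.exists_nonzero_dvd (mem_nonZeroDivisors_of_ne_zero hQ)
  set ρ : ℝ := max ρ₀ r.cauchyBound + 1 with hρ
  have hρr : (r.cauchyBound : ℝ) < ρ := by
    have := le_max_right ρ₀ (r.cauchyBound : ℝ)
    linarith
  have hρ0 : ρ₀ ≤ ρ := by
    have := le_max_left ρ₀ (r.cauchyBound : ℝ)
    linarith
  have hne : ∀ φ : A →ₐ[ℂ] ℂ, ‖φ (algebraMap ℂ[X] A X)‖ = ρ → φ Q ≠ 0 := by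
    intro φ hφ h0
    have h1 := congrArg φ hQ'
    rw [map_mul, h0, zero_mul, algHom_algebraMap_polynomial] at h1
    have h2 : ‖φ (algebraMap ℂ[X] A X)‖ < r.cauchyBound :=
      IsRoot.norm_lt_cauchyBound hr0 h1
    linarith
  obtain ⟨T, hT⟩ := hx (algebraMap ℂ[X] A X)
  obtain ⟨G, hG⟩ := hx Q
  have hK : IsCompact ({z : ι → ℂ | ∃ φ : A →ₐ[ℂ] ℂ, (∀ i, φ (x i) = z i) ∧
      ‖φ (algebraMap ℂ[X] A X)‖ ≤ ρ} ∩ {z | ‖MvPolynomial.eval z T‖ = ρ}) :=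
    (isCompact_setOf_norm_le hx ρ).inter_right
      (isClosed_eq (MvPolynomial.continuous_eval T).norm continuous_const)
  obtain ⟨ε, hε, hKε⟩ := hK.exists_forall_le' (a := (0 : ℝ))
    (f := fun z => ‖MvPolynomial.eval z G‖) (MvPolynomial.continuous_eval G).norm.continuousOn (by
      rintro z ⟨⟨φ, hφ, -⟩, hzT⟩
      obtain rfl : (fun i => φ (x i)) = z := funext hφ
      rw [Set.mem_ofPred_eq, ← algHom_aeval_eq_eval, hT] at hzT
      rw [← algHom_aeval_eq_eval, hG, norm_pos_iff]
      exact hne φ hzT)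
  refine ⟨ρ, ε, hρ0, lt_of_le_of_lt r.cauchyBound.2 hρr, hε, fun φ hφ => ?_⟩
  have := hKε (fun i => φ (x i)) ⟨⟨φ, fun _ => rfl, hφ.le⟩, by
    rw [Set.mem_ofPred_eq, ← algHom_aeval_eq_eval, hT, hφ]⟩
  rwa [← algHom_aeval_eq_eval, hG] at this

theorem exists_bernstein_walsh_constant {A ι : Type*} [Finite ι] [CommRing A] [IsDomain A]
    [Algebra ℂ A] [Algebra ℂ[X] A] [IsScalarTower ℂ ℂ[X] A] [Module.Finite ℂ[X] A]
    [FaithfulSMul ℂ[X] A] {x : ι → A}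
    (hx : Function.Surjective (MvPolynomial.aeval x : MvPolynomial ι ℂ →ₐ[ℂ] A)) {φ₀ : A →ₐ[ℂ] ℂ}
    (ht₀ : φ₀ (algebraMap ℂ[X] A X) = 0) {U : Set (ι → ℂ)} (hU : IsOpen U)
    (hφ₀ : (fun i => φ₀ (x i)) ∈ U) (ρ₀ : ℝ) :
    ∃ M : ℝ, 0 < M ∧ ∀ F : MvPolynomial ι ℂ, F.totalDegree ≠ 0 → ∀ S : ℝ, 0 ≤ S →
      (∀ φ : A →ₐ[ℂ] ℂ, (fun i => φ (x i)) ∈ U → ‖φ (MvPolynomial.aeval x F)‖ ≤ S) →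
      ∀ φ : A →ₐ[ℂ] ℂ, ‖φ (algebraMap ℂ[X] A X)‖ ≤ ρ₀ →
        ‖φ (MvPolynomial.aeval x F)‖ ≤ M ^ F.totalDegree * S := by
  have : Algebra.FiniteType ℂ A := Algebra.FiniteType.trans (S := ℂ[X]) inferInstance inferInstance
  set t := algebraMap ℂ[X] A X with ht
  have ht0 : t ≠ 0 := by
    rw [ht, Ne, map_eq_zero_iff _ (FaithfulSMul.algebraMap_injective ℂ[X] A)]
    exact X_ne_zero
  let L := Localization.Away t
  have hle : Submonoid.powers t ≤ nonZeroDivisors A :=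
    powers_le_nonZeroDivisors_of_noZeroDivisors ht0
  have : IsDomain L := IsLocalization.isDomain_localization hle
  have : FaithfulSMul A L := by
    rw [faithfulSMul_iff_algebraMap_injective]
    exact IsLocalization.injective L hle
  let s : L := IsLocalization.Away.invSelf t
  have hs : s * algebraMap A L t = 1 := by
    rw [mul_comm]; exact IsLocalization.Away.mul_invSelf t
  -- a function `v = Q / t ^ a` whose only pole is the given point
  obtain ⟨u, hu0, hu1⟩ := exists_separating_point hx φ₀
  rw [← ht, ht₀] at hu1
  have hufib : ∀ φ : A →ₐ[ℂ] ℂ, φ t = 0 → φ u = 0 → φ = φ₀ := by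
    intro φ h1 h2
    by_contra hne
    rw [hu1 φ h1 hne] at h2
    exact one_ne_zero h2
  obtain ⟨N₀, hN₀⟩ := exists_dvd_pow_of_forall_algHom (t := t) (f := u * (1 - u)) (by
    intro φ hφ
    by_cases h : φ = φ₀
    · simp [h, hu0]
    · simp [hu1 φ hφ h])
  obtain ⟨a, N, Q, q, hQ0, hQq, hint⟩ := exists_separating_function hs φ₀ ht₀ hu0 hN₀
  set v : L := algebraMap A L Q * s ^ a with hv
  have hsa : s ^ a * algebraMap A L t ^ a = 1 := by rw [← mul_pow, hs, one_pow]
  have hvQ : v * algebraMap A L (t ^ a) = algebraMap A L Q := by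
    rw [map_pow, hv]
    linear_combination algebraMap A L Q * hsa
  have hvq : v * algebraMap A L (u ^ N) = algebraMap A L q := by
    have h := congrArg (algebraMap A L) hQq
    rw [map_mul, map_mul (algebraMap A L) (t ^ a), map_pow (algebraMap A L) t] at h
    rw [hv]
    linear_combination s ^ a * h + algebraMap A L q * hsa
  have hv0 : v ≠ 0 := by
    intro h0
    rw [h0, zero_mul, eq_comm, map_eq_zero_iff _ (FaithfulSMul.algebraMap_injective A L)] at hvQ
    exact hQ0 hvQ
  have hvinj := aeval_injective_of_isIntegral hs hv0 hint
  obtain ⟨k, hk⟩ : ∃ k : ℕ, ∀ i,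
      IsIntegral (Algebra.adjoin ℂ {v}) (algebraMap A L (x i) * v ^ k) := by
    have := Fintype.ofFinite ι
    choose D hD using fun i => exists_isIntegral_mul_pow hs
      (isIntegral_adjoin_algebraMap (L := L) (x i))
    exact ⟨Finset.univ.sup D, fun i => isIntegral_adjoin_mul_pow hs hint
      (hD i _ (Finset.le_sup (Finset.mem_univ i)))⟩
  obtain ⟨B, w, y, hw, hy, c₁, hc₁, hmax₁⟩ := exists_norm_le_of_isIntegral_adjoin hvinj hk
  rw [← hw] at hy
  obtain ⟨c₂, hc₂, hmax₂⟩ := exists_norm_le_of_norm_le_on_circle A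
  obtain ⟨R, hR, hRU⟩ := exists_mem_of_le_norm (L := L) (N := N) (q := q) hx hs hufib hint hU hφ₀
  obtain ⟨ρ, ε, hρ₀, hρ, hε, hQε⟩ := exists_le_norm_on_circle hx hQ0 ρ₀
  set Λ : ℝ := max 1 (R * ρ ^ a / ε) with hΛ
  have hΛ1 : 1 ≤ Λ := le_max_left _ _
  refine ⟨c₂ * c₁ * Λ ^ k, by positivity, fun F hF S hS hFS φ hφ => ?_⟩
  set d := F.totalDegree
  set f := MvPolynomial.aeval x F
  -- the homogenised function on the second model of the curve
  obtain ⟨b, hb, -⟩ := exists_homogenization hy F le_rfl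
  have hb' : (b : L) = (w : L) ^ (k * d) * algebraMap A L f := by
    rw [hb]
    congr 1
    exact (MvPolynomial.comp_aeval_apply x (IsScalarTower.toAlgHom ℂ A L) F).symm
  have hbound : ∀ ψ : B →ₐ[ℂ] ℂ, ‖ψ w‖ ≤ R → ‖ψ b‖ ≤ c₁ * (R ^ (k * d) * S) := by
    refine hmax₁ b R (R ^ (k * d) * S) hR (by positivity) fun ψ hψ => ?_
    have hψ0 : ψ w ≠ 0 := by
      rw [← norm_pos_iff, hψ]; exact hR
    obtain ⟨χ, hχ1, hχ2⟩ := exists_algHom_of_homogeneous hx hy hψ0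
    have h1 := hχ2 (t ^ a) Q (by rw [hw, hvQ])
    have h2 := hχ2 (u ^ N) q (by rw [hw, hvq])
    rw [map_pow] at h1 h2
    have hmem := hRU χ (ψ w) h1.symm (by rw [← h2, mul_comm]) hψ.ge
    rw [hχ1 F d le_rfl b hb', norm_mul, norm_pow, hψ]
    gcongr
    exact hFS χ hmem
  have hcirc : ∀ χ : A →ₐ[ℂ] ℂ, ‖χ t‖ = ρ → ‖χ f‖ ≤ c₁ * Λ ^ (k * d) * S := by
    intro χ hχ
    have hχ0 : χ t ≠ 0 := by
      rw [← norm_pos_iff, hχ]; exact hρ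
    obtain ⟨ψ, hψ⟩ := exists_algHom_extending_away (L := L) hχ0
    have hψv : χ Q = ψ v * χ t ^ a := by rw [← hψ, ← hvQ, map_mul, hψ, map_pow]
    have hψq : χ u ^ N * ψ v = χ q := by
      have h := congrArg ψ hvq
      rw [map_mul ψ v, hψ, hψ, map_pow] at h
      rw [← h, mul_comm]
    rcases le_total R ‖ψ v‖ with hle | hle
    · refine (hFS χ (hRU χ (ψ v) hψv hψq hle)).trans (le_mul_of_one_le_left hS ?_)
      exact one_le_mul_of_one_le_of_one_le hc₁ (one_le_pow₀ hΛ1)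
    · have h1 := hbound (ψ.comp B.val) (by simpa [hw] using hle)
      rw [AlgHom.comp_apply, Subalgebra.val_apply, hb', hw, map_mul, map_pow, hψ, norm_mul,
        norm_pow] at h1
      have h2 : R ≤ Λ * ‖ψ v‖ := by
        have h3 := hQε χ hχ
        rw [hψv, norm_mul, norm_pow, hχ] at h3
        have h4 : R * ρ ^ a / ε ≤ Λ := le_max_right _ _
        have h5 : 0 < ‖ψ v‖ := by
          by_contra! h
          have : ‖ψ v‖ = 0 := le_antisymm h (norm_nonneg _)
          rw [this, zero_mul] at h3
          linarith
        rw [div_le_iff₀ hε] at h4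
        have h6 : R * ρ ^ a ≤ Λ * ‖ψ v‖ * ρ ^ a := by nlinarith
        exact le_of_mul_le_mul_right h6 (by positivity)
      have h5 : 0 < ‖ψ v‖ := by
        by_contra! h
        have : ‖ψ v‖ = 0 := le_antisymm h (norm_nonneg _)
        rw [this, mul_zero] at h2
        linarith
      refine le_of_mul_le_mul_left (h1.trans ?_) (by positivity : 0 < ‖ψ v‖ ^ (k * d))
      calc c₁ * (R ^ (k * d) * S) ≤ c₁ * ((Λ * ‖ψ v‖) ^ (k * d) * S) := by gcongr
        _ = _ := by rw [mul_pow]; ring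
  have hfin := hmax₂ f ρ _ hρ (by positivity) hcirc φ (hφ.trans hρ₀)
  refine hfin.trans ?_
  rw [← mul_assoc, ← mul_assoc]
  refine mul_le_mul_of_nonneg_right ?_ hS
  rw [mul_pow, ← pow_mul]
  gcongr
  exact le_self_pow₀ (one_le_mul_of_one_le_of_one_le hc₂ hc₁) hF

theorem exists_aeval_injective_finite_of_algHom {A : Type*} [CommRing A] [IsDomain A] [Algebra ℂ A]
    [Algebra.FiniteType ℂ A] (hdim : ringKrullDim A = 1) (φ₀ : A →ₐ[ℂ] ℂ) :
    ∃ t : A, φ₀ t = 0 ∧ Function.Injective (aeval t : ℂ[X] →ₐ[ℂ] A) ∧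
      (aeval t : ℂ[X] →ₐ[ℂ] A).Finite := by
  obtain ⟨t, hinj, hfin⟩ := exists_aeval_injective_finite A hdim
  have h : (aeval (t - algebraMap ℂ A (φ₀ t)) : ℂ[X] →ₐ[ℂ] A) =
      (aeval t).comp (algEquivAevalXAddC (-φ₀ t)).toAlgHom := by
    ext
    simp [sub_eq_add_neg]
  refine ⟨t - algebraMap ℂ A (φ₀ t), by simp, ?_, ?_⟩
  · rw [h]
    exact hinj.comp (algEquivAevalXAddC (-φ₀ t)).injective
  · rw [h]
    exact hfin.comp (AlgHom.Finite.of_surjective _ (algEquivAevalXAddC (-φ₀ t)).surjective)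

end Auxiliary

/-- **Bernstein–Walsh-type inequality on an irreducible algebraic curve.** Let `C ⊆ ℂⁿ` be
an irreducible algebraic curve (the zero set of a prime ideal whose quotient has Krull
dimension `1`), and let `D₁, D₂ ⊆ C` be compact with `D₁` of nonempty interior in `C`. Then
there is `M > 0` such that `‖P‖_{D₂} ≤ M^{deg P} · ‖P‖_{D₁}` for every polynomial `P`. -/
theorem bernstein_walsh_on_curve (n : ℕ)
    (p : Ideal (MvPolynomial (Fin n) ℂ)) (hp : p.IsPrime)
    (hdim : ringKrullDim (MvPolynomial (Fin n) ℂ ⧸ p) = 1)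
    (C : Set (Fin n → ℂ)) (hC : C = {z | ∀ q ∈ p, MvPolynomial.eval z q = 0})
    (D₁ D₂ : Set (Fin n → ℂ)) (hD₁ : IsCompact D₁) (hD₂ : IsCompact D₂)
    (hD₁C : D₁ ⊆ C) (hD₂C : D₂ ⊆ C)
    (hint : ∃ U : Set (Fin n → ℂ), IsOpen U ∧ (U ∩ C).Nonempty ∧ U ∩ C ⊆ D₁) :
    ∃ M : ℝ, 0 < M ∧ ∀ P : MvPolynomial (Fin n) ℂ, ∀ z ∈ D₂,
      ‖MvPolynomial.eval z P‖ ≤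
        M ^ P.totalDegree * sSup ((fun w => ‖MvPolynomial.eval w P‖) '' D₁) := by
  obtain ⟨U, hU, ⟨w₀, hw₀U, hw₀C⟩, hUD⟩ := hint
  let A := MvPolynomial (Fin n) ℂ ⧸ p
  let x : Fin n → A := fun i => Ideal.Quotient.mk p (MvPolynomial.X i)
  have hxmk : ∀ F : MvPolynomial (Fin n) ℂ, MvPolynomial.aeval x F = Ideal.Quotient.mk p F := by
    have h : (MvPolynomial.aeval x : MvPolynomial (Fin n) ℂ →ₐ[ℂ] A) = Ideal.Quotient.mkₐ ℂ p := by
      ext i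
      simp [x]
      rfl
    exact fun F => DFunLike.congr_fun h F
  have hx : Function.Surjective (MvPolynomial.aeval x : MvPolynomial (Fin n) ℂ →ₐ[ℂ] A) := by
    intro f
    obtain ⟨F, rfl⟩ := Ideal.Quotient.mk_surjective f
    exact ⟨F, hxmk F⟩
  have hpoint : ∀ z ∈ C, ∃ φ : A →ₐ[ℂ] ℂ, (fun i => φ (x i)) = z := by
    intro z hz
    rw [hC] at hz
    obtain ⟨φ, hφ⟩ := exists_algHom_of_eval_eq_zero hx (z := z) fun F hF =>
      hz F (Ideal.Quotient.eq_zero_iff_mem.1 (by rw [← hxmk, hF]))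
    exact ⟨φ, funext hφ⟩
  have hmem : ∀ φ : A →ₐ[ℂ] ℂ, (fun i => φ (x i)) ∈ C := by
    intro φ
    rw [hC]
    intro q hq
    rw [← algHom_aeval_eq_eval, hxmk, Ideal.Quotient.eq_zero_iff_mem.2 hq, map_zero]
  have hle : ∀ P : MvPolynomial (Fin n) ℂ, ∀ w ∈ D₁, ‖MvPolynomial.eval w P‖ ≤
      sSup ((fun w => ‖MvPolynomial.eval w P‖) '' D₁) := fun P w hw =>
    le_csSup (hD₁.image (MvPolynomial.continuous_eval P).norm).bddAbove
      (Set.mem_image_of_mem _ hw)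
  obtain ⟨φ₀, rfl⟩ := hpoint w₀ hw₀C
  obtain ⟨t, ht₀, hinj, hfin⟩ := exists_aeval_injective_finite_of_algHom hdim φ₀
  let _ : Algebra (Polynomial ℂ) A := (Polynomial.aeval t : Polynomial ℂ →ₐ[ℂ] A).toAlgebra
  have : IsScalarTower ℂ (Polynomial ℂ) A := IsScalarTower.of_algebraMap_eq fun c => by
    exact ((Polynomial.aeval t : Polynomial ℂ →ₐ[ℂ] A).commutes c).symm
  have : FaithfulSMul (Polynomial ℂ) A := by
    rw [faithfulSMul_iff_algebraMap_injective]
    exact hinj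
  have : Module.Finite (Polynomial ℂ) A := hfin
  have htX : algebraMap (Polynomial ℂ) A Polynomial.X = t := Polynomial.aeval_X t
  obtain ⟨T, hT⟩ := hx t
  obtain ⟨ρ, hρ⟩ := hD₂.exists_bound_of_continuousOn (MvPolynomial.continuous_eval T).continuousOn
  obtain ⟨M, hM, hbound⟩ := exists_bernstein_walsh_constant hx (φ₀ := φ₀)
    (by rw [htX, ht₀]) hU hw₀U ρ
  refine ⟨M, hM, fun P z hz => ?_⟩
  obtain ⟨φ, rfl⟩ := hpoint z (hD₂C hz)
  by_cases hP : P.totalDegree = 0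
  · rw [hP, pow_zero, one_mul]
    rw [MvPolynomial.totalDegree_eq_zero_iff_eq_C] at hP
    convert hle P _ (hUD ⟨hw₀U, hw₀C⟩) using 2
    rw [hP, MvPolynomial.eval_C, MvPolynomial.eval_C]
  · rw [← algHom_aeval_eq_eval]
    refine hbound P hP _ ((norm_nonneg _).trans (hle P _ (hUD ⟨hw₀U, hw₀C⟩))) (fun ψ hψ => ?_) φ ?_
    · rw [algHom_aeval_eq_eval]
      exact hle P _ (hUD ⟨hψ, hmem ψ⟩)
    · rw [htX, ← hT, algHom_aeval_eq_eval]
      exact hρ _ hz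
end
end
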